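/- arXiv:1311.5963 — 3 statements merged into one kernel-verified Lean document; each statement's English description precedes it below -/
import Mathlib

section
/- For every i ∈ {0,…,n}, the R-module M_i = (S ⊗_k V_i)^G is indecomposable: M_i ≠ 0, and whenever M_i is the internal direct sum of two R-submodules N_1 and N_2, one of N_1, N_2 is zero. -/
/-!
Each `M_i = (S ⊗_k V_i)^G` is an indecomposable `R`-module: it is nonzero, and if it is
the internal direct sum of two `R`-submodules then one of them is zero.
-/

set_option linter.unusedSectionVars false
set_option synthInstance.maxHeartbeats 1000000
set_option maxHeartbeats 1600000

open MvPolynomial TensorProduct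

section Defs

variable (k : Type) [Field k] (d : ℕ) (G : Type) [Group G] [Fintype G]
variable [MulSemiringAction G (MvPolynomial (Fin d) k)]
variable [SMulCommClass G k (MvPolynomial (Fin d) k)]

/-- The invariant subring `R = S^G` as a subalgebra of `S = k[x_1, …, x_d]`. -/
def invariantSubalgebra : Subalgebra k (MvPolynomial (Fin d) k) where
  carrier := MulAction.fixedPoints G (MvPolynomial (Fin d) k)
  mul_mem' := by
    intro a b ha hb g
    rw [smul_mul', ha g, hb g]
  add_mem' := by
    intro a b ha hb g
    rw [smul_add, ha g, hb g]
  algebraMap_mem' := by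
    intro c g
    rw [Algebra.algebraMap_eq_smul_one, smul_comm, smul_one]

variable (W : Type) [AddCommGroup W] [Module k W] [DistribMulAction G W] [SMulCommClass G k W]

/-- The diagonal action of `g ∈ G` on `S ⊗_k W`. -/
noncomputable def diagAction (g : G) :
    (MvPolynomial (Fin d) k ⊗[k] W) →ₗ[k] (MvPolynomial (Fin d) k ⊗[k] W) :=
  TensorProduct.map (DistribMulAction.toLinearMap k _ g) (DistribMulAction.toLinearMap k W g)

theorem diagAction_smul (g : G) (s : MvPolynomial (Fin d) k) (x : MvPolynomial (Fin d) k ⊗[k] W) :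
    diagAction k d G W g (s • x) = (g • s) • diagAction k d G W g x := by
  induction x using TensorProduct.induction_on with
  | zero => simp
  | tmul s' w =>
      simp only [TensorProduct.smul_tmul', diagAction, TensorProduct.map_tmul,
        DistribMulAction.toLinearMap, DistribSMul.toLinearMap_apply, smul_eq_mul, smul_mul']
  | add x y hx hy =>
      simp only [smul_add, map_add, hx, hy]

/-- `(S ⊗_k W)^G` (invariants of the diagonal action) as a module over `R = S^G`. -/
noncomputable def invariantsTensor : Submodule (invariantSubalgebra k d G)
    (MvPolynomial (Fin d) k ⊗[k] W) where
  carrier := {x | ∀ g : G, diagAction k d G W g x = x}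
  add_mem' := by
    intro a b ha hb g
    rw [map_add, ha g, hb g]
  zero_mem' := by intro g; rw [map_zero]
  smul_mem' := by
    intro r x hx g
    have h : (r : MvPolynomial (Fin d) k) • x = r • x := rfl
    rw [← h, diagAction_smul, r.2 g, hx g]

/-- A representation of `G` over `k` is irreducible if it is nonzero and has no nontrivial
`G`-stable subspaces. -/
def IsIrreducibleRep (M : Type) [AddCommGroup M] [Module k M] [DistribMulAction G M]
    [SMulCommClass G k M] : Prop :=
  Nontrivial M ∧
    ∀ N : Submodule k M, (∀ g : G, ∀ x ∈ N, g • x ∈ N) → N = ⊥ ∨ N = ⊤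

/-- Two representations of `G` over `k` are isomorphic if there is a `G`-equivariant
`k`-linear equivalence between them. -/
def IsRepIso (M M' : Type) [AddCommGroup M] [Module k M] [DistribMulAction G M]
    [SMulCommClass G k M] [AddCommGroup M'] [Module k M'] [DistribMulAction G M']
    [SMulCommClass G k M'] : Prop :=
  ∃ φ : M ≃ₗ[k] M', ∀ (g : G) (x : M), φ (g • x) = g • φ x

end Defs

section Abs

variable {S : Type*} [CommRing S] {G : Type*} [Group G] [Fintype G] [MulSemiringAction G S]
  {E : Type*} [AddCommGroup E] [Module S E]

theorem aux_key (D : G → E →+ E) (D1 : ∀ x, D 1 x = x)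
    (hD : ∀ g (s : S) x, D g (s • x) = (g • s) • D g x) [DecidableEq G]
    (s : G → S) (y : E) :
    (∏ g ∈ Finset.univ.erase (1 : G), (s g - g⁻¹ • s g)) • y ∈
      Submodule.span S (Set.range fun t : S => ∑ g, D g (t • y)) := by
  let m : S →* (G → S) :=
    { toFun := fun t h => h • t
      map_one' := by ext h; simp
      map_mul' := by intro a b; ext h; simp }
  let J : Subalgebra S (G → S) := Algebra.adjoin S (Set.range m)
  have hJ : Subalgebra.toSubmodule J = Submodule.span S (Set.range m) := by
    rw [Algebra.adjoin_eq_span, ← MonoidHom.coe_mrange, Submonoid.closure_eq]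
  have key : ∀ φ ∈ J, ∑ h, φ h • D h y ∈
      Submodule.span S (Set.range fun t : S => ∑ g, D g (t • y)) := by
    intro φ hφ
    rw [← Subalgebra.mem_toSubmodule, hJ] at hφ
    induction hφ using Submodule.span_induction with
    | mem x hx =>
      obtain ⟨t, rfl⟩ := hx
      apply Submodule.subset_span
      refine ⟨t, ?_⟩
      simp only [hD]
      rfl
    | zero => simp
    | add a b _ _ ha hb =>
      simp only [Pi.add_apply, add_smul, Finset.sum_add_distrib]
      exact add_mem ha hb
    | smul c a _ ha =>
      simp only [Pi.smul_apply, smul_eq_mul, mul_smul, ← Finset.smul_sum]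
      exact Submodule.smul_mem _ _ ha
  let ψ : G → (G → S) := fun g => algebraMap S (G → S) (s g) - m (g⁻¹ • s g)
  have hψ : ∀ g, ψ g ∈ J := fun g =>
    sub_mem (J.algebraMap_mem _) (Algebra.subset_adjoin ⟨_, rfl⟩)
  have h1 := key (∏ g ∈ Finset.univ.erase (1 : G), ψ g) (prod_mem fun g _ => hψ g)
  rw [Finset.sum_eq_single (1 : G)] at h1
  · rw [D1] at h1
    convert h1 using 2
    rw [Finset.prod_apply]
    apply Finset.prod_congr rfl
    intro g _
    simp [ψ, m]
  · intro h _ hh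
    rw [Finset.prod_apply, Finset.prod_eq_zero (i := h), zero_smul]
    · simp [hh]
    · simp [ψ, m]
  · simp

theorem aux_div [IsDomain S] [UniqueFactorizationMonoid S]
    (hprime : ∀ (f b : S) (y : E), Prime f → ¬ f ∣ b → (∃ z, b • y = f • z) → ∃ z, y = f • z)
    (htf : ∀ (a : S) (x : E), a ≠ 0 → a • x = 0 → x = 0)
    (B : Set S) (hB : ∀ f : S, Prime f → ∃ b ∈ B, ¬ f ∣ b) (a : S) (ha : a ≠ 0) :
    ∀ y : E, (∀ b ∈ B, ∃ z, b • y = a • z) → ∃ z, y = a • z := by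
  induction a using UniqueFactorizationMonoid.induction_on_prime with
  | h₁ => exact absurd rfl ha
  | h₂ x hx =>
    intro y _
    obtain ⟨u, rfl⟩ := hx
    exact ⟨(↑u⁻¹ : S) • y, by rw [smul_smul, Units.mul_inv, one_smul]⟩
  | h₃ a f ha0 hf ih =>
    intro y hy
    obtain ⟨b, hb, hfb⟩ := hB f hf
    obtain ⟨w, rfl⟩ := hprime f b y hf hfb (by
      obtain ⟨z, hz⟩ := hy b hb
      exact ⟨a • z, by rw [hz, mul_smul]⟩)
    obtain ⟨v, rfl⟩ := ih ha0 w (by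
      intro c hc
      obtain ⟨z, hz⟩ := hy c hc
      refine ⟨z, ?_⟩
      have : f • (c • w - a • z) = 0 := by
        rw [smul_sub, smul_smul, smul_smul, ← hz, smul_smul, mul_comm c f, sub_self]
      exact sub_eq_zero.1 (htf _ _ hf.ne_zero this))
    exact ⟨v, by rw [mul_smul]⟩

def satur [IsDomain S] (P : Submodule S E) : Submodule S E where
  carrier := {x | ∃ a : S, a ≠ 0 ∧ a • x ∈ P}
  zero_mem' := ⟨1, one_ne_zero, by simp⟩
  add_mem' := by
    rintro x y ⟨a, ha, hx⟩ ⟨b, hb, hy⟩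
    refine ⟨a * b, mul_ne_zero ha hb, ?_⟩
    rw [smul_add]
    refine add_mem ?_ ?_
    · rw [mul_comm, mul_smul]; exact P.smul_mem _ hx
    · rw [mul_smul]; exact P.smul_mem _ hy
  smul_mem' := by
    rintro c x ⟨a, ha, hx⟩
    exact ⟨a, ha, by rw [smul_comm]; exact P.smul_mem _ hx⟩

theorem aux_decomp [IsDomain S] [UniqueFactorizationMonoid S]
    (hprime : ∀ (f b : S) (y : E), Prime f → ¬ f ∣ b → (∃ z, b • y = f • z) → ∃ z, y = f • z)
    (htf : ∀ (a : S) (x : E), a ≠ 0 → a • x = 0 → x = 0)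
    (D : G → E →+ E) (D1 : ∀ x, D 1 x = x) (Dm : ∀ g h x, D g (D h x) = D (g * h) x)
    (hD : ∀ g (s : S) x, D g (s • x) = (g • s) • D g x)
    (hinert : ∀ f : S, Prime f → ∀ g : G, g ≠ 1 → ∃ s : S, ¬ f ∣ s - g • s)
    (hfaith : ∀ g : G, g ≠ 1 → ∃ s : S, s - g • s ≠ 0)
    (N₁ N₂ : AddSubgroup E)
    (hf₁ : ∀ x ∈ N₁, ∀ g, D g x = x) (hf₂ : ∀ x ∈ N₂, ∀ g, D g x = x)
    (hs₁ : ∀ x ∈ N₁, ∀ s : S, (∀ g : G, g • s = s) → s • x ∈ N₁)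
    (hs₂ : ∀ x ∈ N₂, ∀ s : S, (∀ g : G, g • s = s) → s • x ∈ N₂)
    (hdisj : ∀ x ∈ N₁, x ∈ N₂ → x = 0)
    (hsup : ∀ x, (∀ g, D g x = x) → ∃ y ∈ N₁, ∃ z ∈ N₂, y + z = x) :
    ∃ A₁ A₂ : Submodule S E, (∀ x ∈ N₁, x ∈ A₁) ∧ (∀ x ∈ N₂, x ∈ A₂) ∧
      (∀ x ∈ A₁, x ∈ A₂ → x = 0) ∧ (∀ x, ∃ y ∈ A₁, ∃ z ∈ A₂, y + z = x) ∧
      (∀ g, ∀ x ∈ A₁, D g x ∈ A₁) ∧ (∀ g, ∀ x ∈ A₂, D g x ∈ A₂) := by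
  classical
  have Tinv : ∀ x g, D g (∑ h, D h x) = ∑ h, D h x := by
    intro x g
    rw [map_sum]
    simp only [Dm]
    exact Fintype.sum_equiv (Equiv.mulLeft g) _ _ (fun h => rfl)
  have trinv : ∀ (s : S) (g : G), g • (∑ h : G, h • s) = ∑ h : G, h • s := by
    intro s g
    rw [Finset.smul_sum]
    simp only [smul_smul]
    exact Fintype.sum_equiv (Equiv.mulLeft g) _ _ (fun h => rfl)
  -- the trace maps spans back
  have Tspan : ∀ N : AddSubgroup E, (∀ x ∈ N, ∀ g, D g x = x) →
      (∀ x ∈ N, ∀ s : S, (∀ g : G, g • s = s) → s • x ∈ N) →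
      ∀ y ∈ Submodule.span S (N : Set E), ∀ s : S, ∑ g, D g (s • y) ∈ N := by
    intro N hf hs y hy
    induction hy using Submodule.span_induction with
    | mem x hx =>
      intro s
      simp only [hD, hf x hx, ← Finset.sum_smul]
      exact hs x hx _ (trinv s)
    | zero => intro s; simp
    | add a b _ _ ha hb =>
      intro s
      simp only [smul_add, map_add, Finset.sum_add_distrib]
      exact add_mem (ha s) (hb s)
    | smul c a _ ha =>
      intro s
      simp only [smul_smul]
      exact ha _
  have Dspan : ∀ N : AddSubgroup E, (∀ x ∈ N, ∀ g, D g x = x) →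
      ∀ g, ∀ y ∈ satur (Submodule.span S (N : Set E)),
        D g y ∈ satur (Submodule.span S (N : Set E)) := by
    intro N hf g y hy
    obtain ⟨a, ha, hy⟩ := hy
    refine ⟨g • a, by rwa [Ne, smul_eq_zero_iff_eq], ?_⟩
    rw [← hD]
    generalize a • y = w at hy
    induction hy using Submodule.span_induction with
    | mem x hx => rw [hf x hx]; exact Submodule.subset_span hx
    | zero => simp
    | add a b _ _ ha hb => rw [map_add]; exact add_mem ha hb
    | smul c a _ ha => rw [hD]; exact Submodule.smul_mem _ _ ha
  set P₁ := Submodule.span S (N₁ : Set E)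
  set P₂ := Submodule.span S (N₂ : Set E)
  choose! s0 hs0 using hfaith
  have ha0 : (∏ g ∈ Finset.univ.erase (1 : G), (s0 g⁻¹ - g⁻¹ • s0 g⁻¹)) ≠ 0 := by
    rw [Finset.prod_ne_zero_iff]
    intro g hg
    exact hs0 _ (by simpa using hg)
  have hPdisj : ∀ y ∈ P₁, y ∈ P₂ → y = 0 := by
    intro y h1 h2
    have h := aux_key D D1 hD (fun g => s0 g⁻¹) y
    have : Set.range (fun t : S => ∑ g, D g (t • y)) ⊆ {0} := by
      rintro _ ⟨t, rfl⟩
      exact hdisj _ (Tspan N₁ hf₁ hs₁ y h1 t) (Tspan N₂ hf₂ hs₂ y h2 t)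
    have h3 := Submodule.span_mono this h
    rw [Submodule.span_zero_singleton, Submodule.mem_bot] at h3
    exact htf _ _ ha0 h3
  have hB0 : ∀ (s : G → S) (x : E),
      (∏ g ∈ Finset.univ.erase (1 : G), (s g - g⁻¹ • s g)) • x ∈ P₁ ⊔ P₂ := by
    intro s x
    refine Submodule.span_le.2 ?_ (aux_key D D1 hD s x)
    rintro _ ⟨t, rfl⟩
    obtain ⟨y, hy, z, hz, hyz⟩ := hsup _ (Tinv (t • x))
    simp only [SetLike.mem_coe]
    rw [← hyz]
    exact Submodule.add_mem_sup (Submodule.subset_span hy) (Submodule.subset_span hz)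
  refine ⟨satur P₁, satur P₂, ?_, ?_, ?_, ?_, Dspan N₁ hf₁, Dspan N₂ hf₂⟩
  · intro x hx; exact ⟨1, one_ne_zero, by rw [one_smul]; exact Submodule.subset_span hx⟩
  · intro x hx; exact ⟨1, one_ne_zero, by rw [one_smul]; exact Submodule.subset_span hx⟩
  · rintro x ⟨a, ha, hax⟩ ⟨b, hb, hbx⟩
    refine htf (a * b) x (mul_ne_zero ha hb) (hPdisj _ ?_ ?_)
    · rw [mul_comm, mul_smul]; exact Submodule.smul_mem _ _ hax
    · rw [mul_smul]; exact Submodule.smul_mem _ _ hbx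
  · intro x
    have h0 := hB0 (fun g => s0 g⁻¹) x
    set a := ∏ g ∈ Finset.univ.erase (1 : G), (s0 g⁻¹ - g⁻¹ • s0 g⁻¹) with ha_def
    obtain ⟨y, hy, z, hz, hyz⟩ := Submodule.mem_sup.1 h0
    obtain ⟨w, hw⟩ := aux_div hprime htf
      {b : S | ∀ x : E, b • x ∈ P₁ ⊔ P₂} (by
        intro f hf
        choose! s hs using hinert f hf
        refine ⟨_, hB0 (fun g => s g⁻¹), ?_⟩
        rw [hf.dvd_finsetProd_iff]
        rintro ⟨g, hg, hd⟩
        exact hs g⁻¹ (by simpa using hg) hd) a ha0 y (by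
        intro b hb
        obtain ⟨y', hy', z', hz', hyz'⟩ := Submodule.mem_sup.1 (hb x)
        refine ⟨y', ?_⟩
        have e : b • y - a • y' = a • z' - b • z := by
          have : b • (y + z) = a • (y' + z') := by rw [hyz, hyz', smul_comm]
          rw [smul_add, smul_add] at this
          rw [sub_eq_sub_iff_add_eq_add, this, add_comm]
        refine sub_eq_zero.1 (hPdisj _ ?_ ?_)
        · exact sub_mem (P₁.smul_mem _ hy) (P₁.smul_mem _ hy')
        · rw [e]; exact sub_mem (P₂.smul_mem _ hz') (P₂.smul_mem _ hz))
    refine ⟨w, ⟨a, ha0, hw ▸ hy⟩, x - w, ⟨a, ha0, ?_⟩, by abel⟩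
    rw [smul_sub, ← hw, ← hyz, add_sub_cancel_left]
    exact hz

theorem aux_prime {ι : Type*} (b : Module.Basis ι S E) (f c : S) (y : E) (hf : Prime f)
    (hc : ¬ f ∣ c) (h : ∃ z, c • y = f • z) : ∃ z, y = f • z := by
  classical
  obtain ⟨z, hz⟩ := h
  have hd : ∀ i, f ∣ b.repr y i := by
    intro i
    have := congrArg (fun u => b.repr u i) hz
    simp only [map_smul, Finsupp.smul_apply, smul_eq_mul] at this
    exact (hf.dvd_or_dvd ⟨_, this⟩).resolve_left hc
  choose q hq using hd
  refine ⟨∑ i ∈ (b.repr y).support, q i • b i, ?_⟩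
  rw [Finset.smul_sum]
  conv_lhs => rw [← b.linearCombination_repr y]
  rw [Finsupp.linearCombination_apply, Finsupp.sum]
  exact Finset.sum_congr rfl fun i _ => by rw [smul_smul, ← hq]

end Abs

section Conc

variable {k : Type} [Field k] {d : ℕ} {G : Type} [Group G] [Fintype G]
  [MulSemiringAction G (MvPolynomial (Fin d) k)]
  [SMulCommClass G k (MvPolynomial (Fin d) k)]

theorem aux_fix (g : G) (h : ∀ j : Fin d, g • (X j : MvPolynomial (Fin d) k) = X j)
    (s : MvPolynomial (Fin d) k) : g • s = s := by
  have : MulSemiringAction.toAlgHom k (MvPolynomial (Fin d) k) g = AlgHom.id k _ :=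
    MvPolynomial.algHom_ext fun j => by simpa using h j
  simpa using DFunLike.congr_fun this s

theorem aux_inert
    (hlin : ∀ (g : G) (j : Fin d),
      g • (X j : MvPolynomial (Fin d) k) ∈ Submodule.span k (Set.range X))
    (hfaithful : ∀ g : G, (∀ s : MvPolynomial (Fin d) k, g • s = s) → g = 1)
    (hps : ∀ g : G, g ≠ 1 → Module.finrank k
      (Submodule.span k (Set.range fun j : Fin d =>
        g • (X j : MvPolynomial (Fin d) k) - X j)) ≠ 1)
    (f : MvPolynomial (Fin d) k) (hf : Prime f) (g : G) (hg : g ≠ 1) :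
    ∃ s : MvPolynomial (Fin d) k, ¬ f ∣ s - g • s := by
  by_contra! hcon
  set U := Submodule.span k (Set.range fun j : Fin d =>
        g • (X j : MvPolynomial (Fin d) k) - X j) with hU
  have hdiv : ∀ u ∈ U, f ∣ u := by
    have : U ≤ (Ideal.span {f}).restrictScalars k := by
      rw [hU, Submodule.span_le]
      rintro _ ⟨j, rfl⟩
      simp only [Submodule.coe_restrictScalars, SetLike.mem_coe, Ideal.mem_span_singleton]
      rw [← dvd_neg, neg_sub]
      exact hcon _
    intro u hu
    exact Ideal.mem_span_singleton.1 (this hu)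
  have hXle : Submodule.span k (Set.range (X : Fin d → MvPolynomial (Fin d) k)) ≤
      homogeneousSubmodule (Fin d) k 1 := by
    rw [Submodule.span_le]
    rintro _ ⟨j, rfl⟩
    exact isHomogeneous_X _ _
  have hUle : U ≤ homogeneousSubmodule (Fin d) k 1 := by
    rw [hU, Submodule.span_le]
    rintro _ ⟨j, rfl⟩
    exact sub_mem (hXle (hlin g j)) (isHomogeneous_X _ _)
  have hfdeg : f.totalDegree ≠ 0 := by
    intro h0
    rw [totalDegree_eq_zero_iff_eq_C] at h0
    apply hf.not_isUnit
    rw [h0]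
    refine IsUnit.map _ (isUnit_iff_ne_zero.2 ?_)
    intro h
    rw [h, C_0] at h0
    exact hf.ne_zero h0
  have hmul : ∀ u ∈ U, ∃ c : k, u = c • f := by
    intro u hu
    by_cases hu0 : u = 0
    · exact ⟨0, by simp [hu0]⟩
    obtain ⟨q, hq⟩ := hdiv u hu
    have hq0 : q ≠ 0 := by rintro rfl; simp at hq; exact hu0 hq
    have ht : u.totalDegree = 1 := IsHomogeneous.totalDegree (hUle hu) hu0
    rw [hq, totalDegree_mul_of_isDomain hf.ne_zero hq0] at ht
    have : q.totalDegree = 0 := by omega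
    rw [totalDegree_eq_zero_iff_eq_C] at this
    refine ⟨coeff 0 q, ?_⟩
    rw [hq, smul_eq_C_mul, ← this, mul_comm]
  have hUne : U ≠ ⊥ := by
    intro h
    apply hg
    apply hfaithful
    apply aux_fix
    intro j
    have : g • (X j : MvPolynomial (Fin d) k) - X j ∈ U := Submodule.subset_span ⟨j, rfl⟩
    rw [h, Submodule.mem_bot] at this
    exact sub_eq_zero.1 this
  obtain ⟨u, hu, hu0⟩ := Submodule.exists_mem_ne_zero_of_ne_bot hUne
  obtain ⟨c, hc⟩ := hmul u hu
  have hc0 : c ≠ 0 := by rintro rfl; simp at hc; exact hu0 hc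
  have hUf : U = Submodule.span k {f} := by
    apply le_antisymm
    · intro v hv
      obtain ⟨a, rfl⟩ := hmul v hv
      exact Submodule.smul_mem _ _ (Submodule.mem_span_singleton_self f)
    · rw [Submodule.span_singleton_le_iff_mem]
      have : f = c⁻¹ • u := by rw [hc, smul_smul, inv_mul_cancel₀ hc0, one_smul]
      rw [this]; exact U.smul_mem _ hu
  apply hps g hg
  rw [← hU, hUf, finrank_span_singleton hf.ne_zero]

theorem aux_cc
    (hlin : ∀ (g : G) (j : Fin d),
      g • (X j : MvPolynomial (Fin d) k) ∈ Submodule.span k (Set.range X))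
    (g : G) (s : MvPolynomial (Fin d) k) :
    aeval (0 : Fin d → k) (g • s) = aeval (0 : Fin d → k) s := by
  have : (aeval (0 : Fin d → k)).comp (MulSemiringAction.toAlgHom k (MvPolynomial (Fin d) k) g)
      = aeval (0 : Fin d → k) := by
    refine MvPolynomial.algHom_ext fun j => ?_
    have h : Submodule.span k (Set.range (X : Fin d → MvPolynomial (Fin d) k)) ≤
        LinearMap.ker (aeval (R := k) (0 : Fin d → k)).toLinearMap := by
      rw [Submodule.span_le]
      rintro _ ⟨j, rfl⟩
      simp
    have h2 := h (hlin g j)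
    simp only [LinearMap.mem_ker, AlgHom.toLinearMap_apply] at h2
    simpa using h2
  simpa using DFunLike.congr_fun this s

variable {W : Type} [AddCommGroup W] [Module k W] [DistribMulAction G W] [SMulCommClass G k W]

theorem aux_finite (hirr : IsIrreducibleRep k G W) : Module.Finite k W := by
  obtain ⟨hn, h⟩ := hirr
  obtain ⟨v, hv⟩ := exists_ne (0 : W)
  have := h (Submodule.span k (Set.range fun g : G => g • v)) (by
    intro g x hx
    induction hx using Submodule.span_induction with
    | mem x hx =>
      obtain ⟨h, rfl⟩ := hx
      exact Submodule.subset_span ⟨g * h, by simp [mul_smul]⟩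
    | zero => simp
    | add a b _ _ ha hb => rw [smul_add]; exact add_mem ha hb
    | smul c a _ ha => rw [smul_comm]; exact Submodule.smul_mem _ _ ha)
  rcases this with h0 | h1
  · exfalso
    have : v ∈ Submodule.span k (Set.range fun g : G => g • v) :=
      Submodule.subset_span ⟨1, by simp⟩
    rw [h0] at this
    exact hv (by simpa using this)
  · exact ⟨h1 ▸ Submodule.fg_span (Set.finite_range _)⟩

/-- evaluation at the origin -/
noncomputable def aux_ev (k : Type) [Field k] (d : ℕ) (W : Type) [AddCommGroup W] [Module k W] :
    (MvPolynomial (Fin d) k ⊗[k] W) →ₗ[k] W :=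
  (TensorProduct.lid k W).toLinearMap ∘ₗ
    (LinearMap.rTensor W (aeval (R := k) (0 : Fin d → k)).toLinearMap)

theorem aux_ev_tmul (s : MvPolynomial (Fin d) k) (w : W) :
    aux_ev k d W (s ⊗ₜ w) = aeval (0 : Fin d → k) s • w := by
  simp [aux_ev]

theorem aux_ev_smul (s : MvPolynomial (Fin d) k) (x : MvPolynomial (Fin d) k ⊗[k] W) :
    aux_ev k d W (s • x) = aeval (0 : Fin d → k) s • aux_ev k d W x := by
  induction x using TensorProduct.induction_on with
  | zero => simp
  | tmul t w => rw [TensorProduct.smul_tmul', aux_ev_tmul, aux_ev_tmul, smul_eq_mul, map_mul,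
      mul_smul]
  | add x y hx hy => simp only [smul_add, map_add, hx, hy]

theorem aux_ev_diag
    (hlin : ∀ (g : G) (j : Fin d),
      g • (X j : MvPolynomial (Fin d) k) ∈ Submodule.span k (Set.range X))
    (g : G) (x : MvPolynomial (Fin d) k ⊗[k] W) :
    aux_ev k d W (diagAction k d G W g x) = g • aux_ev k d W x := by
  induction x using TensorProduct.induction_on with
  | zero => simp
  | tmul t w =>
    have : diagAction k d G W g (t ⊗ₜ w) = (g • t) ⊗ₜ (g • w) := rfl
    rw [this, aux_ev_tmul, aux_ev_tmul, aux_cc hlin, smul_comm g]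
  | add x y hx hy => simp only [smul_add, map_add, hx, hy]

theorem aux_ev_ker (x : MvPolynomial (Fin d) k ⊗[k] W) :
    x - 1 ⊗ₜ aux_ev k d W x ∈ (RingHom.ker (aeval (R := k) (0 : Fin d → k))) •
      (⊤ : Submodule (MvPolynomial (Fin d) k) (MvPolynomial (Fin d) k ⊗[k] W)) := by
  induction x using TensorProduct.induction_on with
  | zero => simp
  | tmul t w =>
    have : t ⊗ₜ[k] w - 1 ⊗ₜ aux_ev k d W (t ⊗ₜ w) =
        (t - C (aeval (0 : Fin d → k) t)) • ((1 : MvPolynomial (Fin d) k) ⊗ₜ[k] w) := by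
      rw [aux_ev_tmul, TensorProduct.smul_tmul', ← TensorProduct.smul_tmul,
        ← TensorProduct.sub_tmul, smul_eq_C_mul]
      simp
    rw [this]
    refine Submodule.smul_mem_smul ?_ trivial
    simp [RingHom.mem_ker]
  | add x y hx hy =>
    have : x + y - 1 ⊗ₜ aux_ev k d W (x + y) =
      (x - 1 ⊗ₜ aux_ev k d W x) + (y - 1 ⊗ₜ aux_ev k d W y) := by
      rw [map_add, TensorProduct.tmul_add]; abel
    rw [this]
    exact add_mem hx hy

end Conc

section Final

variable {S : Type*} [CommRing S] [IsDomain S] [IsNoetherianRing S]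
  {E : Type*} [AddCommGroup E] [Module S E] [Module.Finite S E]

theorem aux_split_smul (m : Ideal S) (A₁ A₂ : Submodule S E)
    (hsup : ∀ x, ∃ y ∈ A₁, ∃ z ∈ A₂, y + z = x) (x : E) (hx : x ∈ m • (⊤ : Submodule S E)) :
    ∃ y ∈ m • A₁, ∃ z ∈ m • A₂, y + z = x := by
  have : (⊤ : Submodule S E) = A₁ ⊔ A₂ := by
    symm
    rw [eq_top_iff]
    intro x _
    exact Submodule.mem_sup.2 (hsup x)
  rw [this, Submodule.smul_sup] at hx
  exact Submodule.mem_sup.1 hx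

theorem aux_nak (m : Ideal S) (hm : m ≠ ⊤)
    (htf : ∀ (a : S) (x : E), a ≠ 0 → a • x = 0 → x = 0) (A₁ A₂ : Submodule S E)
    (hdisj : ∀ x ∈ A₁, x ∈ A₂ → x = 0)
    (hsup : ∀ x, ∃ y ∈ A₁, ∃ z ∈ A₂, y + z = x)
    (hle : ∀ x ∈ A₁, x ∈ m • (⊤ : Submodule S E)) : ∀ x ∈ A₁, x = 0 := by
  have h1 : A₁ ≤ m • A₁ := by
    intro x hx
    obtain ⟨y, hy, z, hz, hyz⟩ := aux_split_smul m A₁ A₂ hsup x (hle x hx)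
    have hz0 : z = 0 := by
      refine hdisj z ?_ (Submodule.smul_le_right hz)
      have : z = x - y := by rw [← hyz]; abel
      rw [this]
      exact sub_mem hx (Submodule.smul_le_right hy)
    rw [← hyz, hz0, add_zero]
    exact hy
  obtain ⟨r, hr, hr'⟩ := Submodule.exists_sub_one_mem_and_smul_eq_zero_of_fg_of_le_smul m A₁
    (IsNoetherian.noetherian A₁) h1
  intro x hx
  refine htf r x ?_ (hr' x hx)
  rintro rfl
  apply hm
  rw [Ideal.eq_top_iff_one]
  simpa using hr

end Final

theorem invariantsTensor_indecomposable
    (k : Type) [Field k] [IsAlgClosed k] (p : ℕ) [Fact p.Prime] [CharP k p]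
    (d n : ℕ) (G : Type) [Group G] [Fintype G]
    [MulSemiringAction G (MvPolynomial (Fin d) k)]
    [SMulCommClass G k (MvPolynomial (Fin d) k)]
    -- the order of `G` is not divisible by `p`
    (hord : ¬ p ∣ Fintype.card G)
    -- the action of `G` on `S` is induced by a linear action on `V = ⟨x_1, …, x_d⟩`
    (hlin : ∀ (g : G) (j : Fin d),
      g • (X j : MvPolynomial (Fin d) k) ∈ Submodule.span k (Set.range X))
    -- `G ⊆ GL(V)`: the action is faithful
    (hfaithful : ∀ g : G, (∀ s : MvPolynomial (Fin d) k, g • s = s) → g = 1)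
    -- `G` contains no pseudo-reflections: for `g ≠ 1`, `rank (g - 1)|_V ≠ 1`, where the image
    -- of `(g - 1)|_V` is spanned by the elements `g • x_j - x_j`
    (hps : ∀ g : G, g ≠ 1 → Module.finrank k
      (Submodule.span k (Set.range fun j : Fin d =>
        g • (X j : MvPolynomial (Fin d) k) - X j)) ≠ 1)
    -- `V_0 = k, V_1, …, V_n`: a complete set of pairwise non-isomorphic irreducible
    -- representations of `G` over `k`, with `V_0` the trivial one-dimensional representation
    (W : Fin (n + 1) → Type) [∀ i, AddCommGroup (W i)] [∀ i, Module k (W i)]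
    [∀ i, DistribMulAction G (W i)] [∀ i, SMulCommClass G k (W i)]
    (hirr : ∀ i, IsIrreducibleRep k G (W i))
    (hdist : ∀ i j, i ≠ j → ¬ IsRepIso k G (W i) (W j))
    (hcomplete : ∀ (P : Type) [AddCommGroup P] [Module k P] [DistribMulAction G P]
      [SMulCommClass G k P], IsIrreducibleRep k G P → ∃ i, IsRepIso k G P (W i))
    (htriv : Module.finrank k (W 0) = 1 ∧ ∀ (g : G) (x : W 0), g • x = x)
    (i : Fin (n + 1)) :
    -- `M_i ≠ 0` …
    invariantsTensor k d G (W i) ≠ ⊥ ∧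
    -- … and whenever `M_i` is the internal direct sum of `R`-submodules `N₁` and `N₂`,
    -- one of them is zero
    ∀ N₁ N₂ : Submodule (invariantSubalgebra k d G) (invariantsTensor k d G (W i)),
      N₁ ⊓ N₂ = ⊥ → N₁ ⊔ N₂ = ⊤ → N₁ = ⊥ ∨ N₂ = ⊥ := by
  classical
  haveI := aux_finite (hirr i)
  obtain ⟨hnt, hsub⟩ := hirr i
  let S := MvPolynomial (Fin d) k
  let b := Algebra.TensorProduct.basis S (Module.Basis.ofVectorSpace k (W i))
  have htf : ∀ (a : S) (x : S ⊗[k] W i), a ≠ 0 → a • x = 0 → x = 0 := by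
    intro a x ha h
    apply b.repr.injective
    ext1 j
    have := congrArg (fun u => b.repr u j) h
    simp only [map_smul, Finsupp.smul_apply, smul_eq_mul, map_zero, Finsupp.zero_apply] at this
    rw [map_zero, Finsupp.zero_apply]
    exact (mul_eq_zero.1 this).resolve_left ha
  let D : G → (S ⊗[k] W i) →+ (S ⊗[k] W i) := fun g => (diagAction k d G (W i) g).toAddMonoidHom
  have Dt : ∀ g (s : S) (w : W i), D g (s ⊗ₜ w) = (g • s) ⊗ₜ (g • w) := fun g s w => rfl
  have D1 : ∀ x, D 1 x = x := by
    intro x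
    induction x using TensorProduct.induction_on with
    | zero => simp
    | tmul s w => rw [Dt, one_smul, one_smul]
    | add x y hx hy => rw [map_add, hx, hy]
  have Dm : ∀ g h x, D g (D h x) = D (g * h) x := by
    intro g h x
    induction x using TensorProduct.induction_on with
    | zero => simp
    | tmul s w => rw [Dt, Dt, Dt, mul_smul, mul_smul]
    | add x y hx hy => rw [map_add, map_add, map_add, hx, hy]
  have hD : ∀ g (s : S) x, D g (s • x) = (g • s) • D g x := fun g s x =>
    diagAction_smul k d G (W i) g s x
  have hinert := aux_inert hlin hfaithful hps
  have hfaith : ∀ g : G, g ≠ 1 → ∃ s : S, s - g • s ≠ 0 := by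
    intro g hg
    by_contra! h
    exact hg (hfaithful g fun s => (sub_eq_zero.1 (h s)).symm)
  have hMmem : ∀ x, x ∈ invariantsTensor k d G (W i) ↔ ∀ g, D g x = x := fun x => Iff.rfl
  constructor
  · intro hbot
    obtain ⟨v, hv⟩ := exists_ne (0 : W i)
    choose! s0 hs0 using hfaith
    have h := aux_key D D1 hD (fun g => s0 g⁻¹) ((1 : S) ⊗ₜ v)
    have hr : Set.range (fun t : S => ∑ g, D g (t • ((1 : S) ⊗ₜ[k] v))) ⊆ {0} := by
      rintro _ ⟨t, rfl⟩
      have : (∑ g, D g (t • ((1 : S) ⊗ₜ[k] v))) ∈ invariantsTensor k d G (W i) := by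
        rw [hMmem]
        intro g
        rw [map_sum]
        simp only [Dm]
        exact Fintype.sum_equiv (Equiv.mulLeft g) _ _ (fun h => rfl)
      rw [hbot, Submodule.mem_bot] at this
      exact this
    have h3 := Submodule.span_mono hr h
    rw [Submodule.span_zero_singleton, Submodule.mem_bot] at h3
    have h4 := htf _ _ (by
      rw [Finset.prod_ne_zero_iff]
      intro g hg
      exact hs0 _ (by simpa using hg)) h3
    have h5 := congrArg (aux_ev k d (W i)) h4
    rw [aux_ev_tmul, map_one, one_smul, map_zero] at h5
    exact hv h5
  · intro N₁ N₂ hinf hsup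
    let N : Submodule (invariantSubalgebra k d G) (invariantsTensor k d G (W i)) →
      AddSubgroup (S ⊗[k] W i) := fun N =>
        (N.map (invariantsTensor k d G (W i)).subtype).toAddSubgroup
    have hNmem : ∀ P x, x ∈ N P ↔ ∃ y ∈ P, (y : S ⊗[k] W i) = x := fun P x => Iff.rfl
    have hf : ∀ P, ∀ x ∈ N P, ∀ g, D g x = x := by
      intro P x hx
      obtain ⟨y, hy, rfl⟩ := (hNmem _ _).1 hx
      exact y.2
    have hs : ∀ P, ∀ x ∈ N P, ∀ s : S, (∀ g : G, g • s = s) → s • x ∈ N P := by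
      intro P x hx s h
      obtain ⟨y, hy, rfl⟩ := (hNmem _ _).1 hx
      exact ⟨(⟨s, h⟩ : invariantSubalgebra k d G) • y, P.smul_mem _ hy, rfl⟩
    obtain ⟨A₁, A₂, hN₁, hN₂, hA, hAs, hG₁, hG₂⟩ := aux_decomp (aux_prime b) htf D D1 Dm hD hinert
      hfaith (N N₁) (N N₂) (hf _) (hf _) (hs _) (hs _) (by
        intro x h1 h2
        obtain ⟨y, hy, rfl⟩ := (hNmem _ _).1 h1
        obtain ⟨z, hz, hzy⟩ := (hNmem _ _).1 h2
        obtain rfl : z = y := Subtype.ext hzy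
        have : z ∈ N₁ ⊓ N₂ := ⟨hy, hz⟩
        rw [hinf, Submodule.mem_bot] at this
        rw [this]; rfl) (by
        intro x hx
        have : (⟨x, hx⟩ : invariantsTensor k d G (W i)) ∈ N₁ ⊔ N₂ := by rw [hsup]; trivial
        obtain ⟨y, hy, z, hz, hyz⟩ := Submodule.mem_sup.1 this
        exact ⟨y, ⟨y, hy, rfl⟩, z, ⟨z, hz, rfl⟩, congrArg Subtype.val hyz⟩)
    let m : Ideal S := RingHom.ker (aeval (R := k) (0 : Fin d → k))
    have hm : m ≠ ⊤ := RingHom.ker_ne_top _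
    have hev : ∀ x, aux_ev k d (W i) x = 0 → x ∈ m • (⊤ : Submodule S (S ⊗[k] W i)) := by
      intro x hx
      have := aux_ev_ker x
      rwa [hx, TensorProduct.tmul_zero, sub_zero] at this
    have hev' : ∀ A : Submodule S (S ⊗[k] W i), ∀ x ∈ m • A, aux_ev k d (W i) x = 0 := by
      intro A x hx
      refine Submodule.smul_induction_on hx ?_ ?_
      · intro r hr n _
        rw [aux_ev_smul, (RingHom.mem_ker).1 hr, zero_smul]
      · intro x y hx hy
        rw [map_add, hx, hy, add_zero]
    let Q : Submodule S (S ⊗[k] W i) → Submodule k (W i) := fun A =>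
      (A.restrictScalars k).map (aux_ev k d (W i))
    have hQ : ∀ A : Submodule S (S ⊗[k] W i), (∀ g, ∀ x ∈ A, D g x ∈ A) →
        Q A = ⊥ ∨ Q A = ⊤ := by
      intro A hA
      apply hsub
      rintro g _ ⟨x, hx, rfl⟩
      exact ⟨D g x, hA g x hx, aux_ev_diag hlin g x⟩
    have hQ0 : ∀ A : Submodule S (S ⊗[k] W i), Q A = ⊥ →
        ∀ x ∈ A, x ∈ m • (⊤ : Submodule S (S ⊗[k] W i)) := by
      intro A hA x hx
      apply hev
      have : aux_ev k d (W i) x ∈ Q A := ⟨x, hx, rfl⟩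
      rw [hA] at this
      simpa using this
    have hfin : ∀ P, ∀ A : Submodule S (S ⊗[k] W i), (∀ x ∈ N P, x ∈ A) →
        (∀ x ∈ A, x = 0) → P = ⊥ := by
      intro P A h1 h2
      rw [Submodule.eq_bot_iff]
      intro y hy
      exact Subtype.ext (h2 _ (h1 _ ⟨y, hy, rfl⟩))
    rcases hQ A₁ hG₁ with h1 | h1
    · left
      exact hfin N₁ A₁ hN₁ (aux_nak m hm htf A₁ A₂ hA hAs (hQ0 A₁ h1))
    rcases hQ A₂ hG₂ with h2 | h2
    · right
      exact hfin N₂ A₂ hN₂ (aux_nak m hm htf A₂ A₁ (fun x h h' => hA x h' h) (fun x => by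
        obtain ⟨y, hy, z, hz, h⟩ := hAs x
        exact ⟨z, hz, y, hy, by rw [add_comm, h]⟩) (hQ0 A₂ h2))
    exfalso
    obtain ⟨v, hv⟩ := exists_ne (0 : W i)
    have hv1 : v ∈ Q A₁ := by rw [h1]; trivial
    have hv2 : v ∈ Q A₂ := by rw [h2]; trivial
    obtain ⟨x, hx, hxv⟩ := hv1
    obtain ⟨y, hy, hyv⟩ := hv2
    obtain ⟨y', hy', z', hz', h⟩ := aux_split_smul m A₁ A₂ hAs (x - y) (hev _ (by
      rw [map_sub, hxv, hyv, sub_self]))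
    have hxy : x - y' = 0 := by
      refine hA _ (sub_mem hx (Submodule.smul_le_right hy')) ?_
      have : x - y' = y + z' := by
        rw [sub_eq_iff_eq_add, add_assoc, add_comm z', h]; abel
      rw [this]
      exact add_mem hy (Submodule.smul_le_right hz')
    apply hv
    rw [← hxv, sub_eq_zero.1 hxy]
    exact hev' _ _ hy'
end

section
/- Multiplicities in direct-sum decompositions into the modules M_i are unique: if a, b : Fin (n+1) → ℕ are such that ⊕_{i=0}^{n} M_i^{⊕ a(i)} ≅ ⊕_{i=0}^{n} M_i^{⊕ b(i)} as R-modules, then a = b. -/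
/-!
Uniqueness of multiplicities: if `⊕_i M_i^{⊕ a i} ≅ ⊕_i M_i^{⊕ b i}` as `R`-modules,
then `a = b`.
-/

set_option linter.unusedSectionVars false
set_option synthInstance.maxHeartbeats 1000000
set_option maxHeartbeats 1600000

open MvPolynomial TensorProduct

section Abs

/-- A module with semilinear action, its invariants and its reduction at the origin. -/
structure EqMod (k R S G X M W : Type) [Field k] [CommRing R] [CommRing S] [Algebra k S] [Group G]
    [MulSemiringAction G S] [AddCommGroup X] [Module S X] [AddCommGroup M] [Module R M]
    [AddCommGroup W] [Module k W] [DistribMulAction G W] (rS : R →+* S) (ε : S →+* k) where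
  ρ : G → X →+ X
  ρ_one : ∀ x, ρ 1 x = x
  ρ_mul : ∀ g h x, ρ (g * h) x = ρ g (ρ h x)
  ρ_smul : ∀ g (s : S) x, ρ g (s • x) = (g • s) • ρ g x
  i : M →+ X
  i_inj : ∀ m m', i m = i m' → m = m'
  i_smul : ∀ r m, i (r • m) = rS r • i m
  i_fix : ∀ g m, ρ g (i m) = i m
  i_surj : ∀ x, (∀ g, ρ g x = x) → ∃ m, i m = x
  j : W →+ X
  j_smul : ∀ (c : k) w, j (c • w) = algebraMap k S c • j w
  j_eq : ∀ g w, ρ g (j w) = j (g • w)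
  j_span : Submodule.span S (Set.range j) = ⊤
  e : X →+ W
  e_smul : ∀ (s : S) x, e (s • x) = ε s • e x
  e_eq : ∀ g x, e (ρ g x) = g • e x
  e_j : ∀ w, e (j w) = w

variable {k R S G X M W : Type} [Field k] [CommRing R] [CommRing S] [Algebra k S] [Group G]
    [MulSemiringAction G S] [AddCommGroup X] [Module S X] [AddCommGroup M] [Module R M]
    [AddCommGroup W] [Module k W] [DistribMulAction G W] {rS : R →+* S} {ε : S →+* k}
  [Fintype G]
variable {Y N W' : Type} [AddCommGroup Y] [Module S Y] [AddCommGroup N] [Module R N]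
    [AddCommGroup W'] [Module k W'] [DistribMulAction G W']
variable {Z L W'' : Type} [AddCommGroup Z] [Module S Z] [AddCommGroup L] [Module R L]
    [AddCommGroup W''] [Module k W''] [DistribMulAction G W'']

/-- Invariance of `R` in `S`. -/
def IsInv (G : Type) [Group G] [MulSemiringAction G S] (rS : R →+* S) : Prop :=
  (∀ (g : G) r, g • rS r = rS r) ∧ ∀ s, (∀ g : G, g • s = s) → ∃ r, rS r = s

section One
variable (A : EqMod k R S G X M W rS ε)

theorem tr_inv (x : X) (g : G) : A.ρ g (∑ h : G, A.ρ h x) = ∑ h : G, A.ρ h x := by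
  rw [map_sum]
  simp_rw [← A.ρ_mul]
  exact Fintype.sum_equiv (Equiv.mulLeft g) _ _ (fun h => rfl)

/-- trace -/
noncomputable def tr (x : X) : M := (A.i_surj (∑ g : G, A.ρ g x) (tr_inv A x)).choose

theorem tr_coe (x : X) : A.i (tr A x) = ∑ g : G, A.ρ g x :=
  (A.i_surj (∑ g : G, A.ρ g x) (tr_inv A x)).choose_spec

theorem tr_add (x y : X) : tr A (x + y) = tr A x + tr A y := by
  apply A.i_inj
  simp [tr_coe, Finset.sum_add_distrib]

theorem tr_zero : tr A 0 = 0 := by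
  apply A.i_inj
  simp [tr_coe]

theorem tr_rho (g : G) (x : X) : tr A (A.ρ g x) = tr A x := by
  apply A.i_inj
  simp only [tr_coe, ← A.ρ_mul]
  exact Fintype.sum_equiv (Equiv.mulRight g) _ _ (fun h => rfl)

theorem tr_smul_inv (c : S) (r : R) (hr : rS r = ∑ g : G, g • c) (m : M) :
    tr A (c • A.i m) = r • m := by
  apply A.i_inj
  rw [tr_coe, A.i_smul, hr, Finset.sum_smul]
  refine Finset.sum_congr rfl fun g _ => ?_
  rw [A.ρ_smul, A.i_fix]

theorem tr_smul_R (hR : IsInv G rS) (r : R) (x : X) : tr A (rS r • x) = r • tr A x := by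
  apply A.i_inj
  rw [tr_coe, A.i_smul, tr_coe, Finset.smul_sum]
  refine Finset.sum_congr rfl fun g _ => ?_
  rw [A.ρ_smul, hR.1]

theorem exists_trS (hR : IsInv G rS) (c : S) : ∃ r, rS r = ∑ g : G, g • c := by
  apply hR.2
  intro g
  rw [Finset.smul_sum]
  simp_rw [← mul_smul]
  exact Fintype.sum_equiv (Equiv.mulLeft g) _ _ (fun h => rfl)

end One

section Ev
variable [SMulCommClass G k S]
variable (k)

/-- `a ⊗ b ↦ a * g b` -/
noncomputable def evg (g : G) : (S ⊗[k] S) →ₐ[k] S :=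
  Algebra.TensorProduct.productMap (AlgHom.id k _) (MulSemiringAction.toAlgHom k _ g)

theorem evg_tmul (g : G) (a b : S) : evg k g (a ⊗ₜ b) = a * g • b := by
  simp [evg]

variable {k}

theorem sum_evg (A : EqMod k R S G X M W rS ε) (a b : S) (x : X) :
    ∑ g : G, evg k g (a ⊗ₜ b) • A.ρ g x = a • A.i (tr A (b • x)) := by
  rw [tr_coe, Finset.smul_sum]
  refine Finset.sum_congr rfl fun g _ => ?_
  rw [evg_tmul, A.ρ_smul, mul_smul]

theorem sum_evg_good (A : EqMod k R S G X M W rS ε) (u : S ⊗[k] S)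
    (hu : ∀ g : G, g ≠ 1 → evg k g u = 0) (x : X) :
    ∑ g : G, evg k g u • A.ρ g x = evg k (1 : G) u • x := by
  classical
  rw [Finset.sum_eq_single 1]
  · rw [A.ρ_one]
  · intro g _ hg
    rw [hu g hg, zero_smul]
  · simp

theorem zero_of_tr (A : EqMod k R S G X M W rS ε) (y : X)
    (hy : ∀ c : S, tr A (c • y) = 0) (u : S ⊗[k] S) :
    ∑ g : G, evg k g u • A.ρ g y = 0 := by
  induction u using TensorProduct.induction_on with
  | zero => simp
  | tmul a b => rw [sum_evg, hy]; simp
  | add u v hu hv => simp only [map_add, add_smul, Finset.sum_add_distrib, hu, hv, add_zero]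

variable (k S G)

/-- enough good elements -/
def Enough : Prop := (∀ f : S, Irreducible f →
  ∃ u : S ⊗[k] S, (∀ g : G, g ≠ 1 → evg k g u = 0) ∧ ¬ f ∣ evg k (1 : G) u) ∧
  ∃ u : S ⊗[k] S, (∀ g : G, g ≠ 1 → evg k g u = 0) ∧ evg k (1 : G) u ≠ 0

variable {G}
theorem good_of (h : G → S) :
    ∃ u : S ⊗[k] S, (∀ g : G, g ≠ 1 → evg k g u = 0) ∧
      ∀ p : S, Prime p ∨ p = 0 ∧ IsDomain S → (∀ g : G, g ≠ 1 → ¬ p ∣ g • h g - h g) →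
        ¬ p ∣ evg k (1 : G) u := by
  classical
  refine ⟨∏ g ∈ Finset.univ.erase (1 : G), ((g • h g) ⊗ₜ 1 - 1 ⊗ₜ h g), ?_, ?_⟩
  · intro g hg
    rw [map_prod]
    apply Finset.prod_eq_zero (i := g) (by simp [hg])
    rw [map_sub, evg_tmul, evg_tmul]
    simp
  · intro p hp hh
    have e : evg k (1 : G) (∏ g ∈ Finset.univ.erase (1 : G), ((g • h g) ⊗ₜ 1 - 1 ⊗ₜ h g)) =
        ∏ g ∈ Finset.univ.erase (1 : G), (g • h g - h g) := by
      rw [map_prod]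
      refine Finset.prod_congr rfl fun g _ => ?_
      rw [map_sub, evg_tmul, evg_tmul]
      simp
    rw [e]
    rcases hp with hp | ⟨rfl, hS⟩
    · rw [hp.dvd_finsetProd_iff]
      rintro ⟨g, hg, hd⟩
      exact hh g (by simpa using hg) hd
    · rw [zero_dvd_iff, Finset.prod_eq_zero_iff]
      rintro ⟨g, hg, hd⟩
      exact hh g (by simpa using hg) (zero_dvd_iff.2 hd)

end Ev

theorem ufd_dvd {S : Type} [CommRing S] [IsDomain S] [UniqueFactorizationMonoid S]
    (s y : S) (hs : s ≠ 0) (h : ∀ f : S, Irreducible f → ∃ t, ¬ f ∣ t ∧ s ∣ t * y) : s ∣ y := by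
  obtain ⟨s', y', c, hrel, h1, h2⟩ := UniqueFactorizationMonoid.exists_reduced_factors s hs y
  have hc : c ≠ 0 := by rintro rfl; simp at h1; exact hs h1.symm
  have hs' : s' ≠ 0 := by rintro rfl; simp at h1; exact hs h1.symm
  have hu : IsUnit s' := by
    by_contra hn
    obtain ⟨f, hf, hfs⟩ := WfDvdMonoid.exists_irreducible_factor hn hs'
    obtain ⟨t, ht, hd⟩ := h f hf
    apply ht
    rw [← h1, ← h2, mul_left_comm] at hd
    have hd' : s' ∣ t * y' := (mul_dvd_mul_iff_left hc).1 hd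
    exact hfs.trans (hrel.dvd_of_dvd_mul_right hd')
  rw [← h1, ← h2]
  exact mul_dvd_mul_left c hu.dvd

theorem basis_dvd {S Y ι : Type} [CommRing S] [AddCommGroup Y] [Module S Y]
    (b : Module.Basis ι S Y) (s : S) (y : Y) (h : ∀ i, s ∣ b.repr y i) : ∃ z, y = s • z := by
  choose q hq using h
  refine ⟨∑ i ∈ (b.repr y).support, q i • b i, ?_⟩
  conv_lhs => rw [← b.linearCombination_repr y, Finsupp.linearCombination_apply, Finsupp.sum]
  rw [Finset.smul_sum]
  refine Finset.sum_congr rfl fun i _ => ?_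
  rw [smul_smul, ← hq]

section Two
variable (A : EqMod k R S G X M W rS ε) (B : EqMod k R S G Y N W' rS ε)
  (C : EqMod k R S G Z L W'' rS ε) (φ : M →ₗ[R] N) (ψ : N →ₗ[R] L)

/-- graph of the extension -/
def Pgr : Submodule S (X × Y) where
  carrier := {z | ∀ c : S, φ (tr A (c • z.1)) = tr B (c • z.2)}
  add_mem' := by
    intro x y hx hy c
    simp only [Prod.fst_add, Prod.snd_add, smul_add, tr_add, map_add]
    rw [hx c, hy c]
  zero_mem' := by
    intro c
    simp [tr_zero]
  smul_mem' := by
    intro s x hx c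
    simp only [Prod.smul_fst, Prod.smul_snd, smul_smul]
    exact hx _

theorem Pgr_inv (hR : IsInv G rS) (m : M) : (A.i m, B.i (φ m)) ∈ Pgr A B φ := by
  intro c
  obtain ⟨r, hr⟩ := exists_trS hR c
  simp only [tr_smul_inv _ c r hr, map_smul]

theorem Pgr_rho (g : G) (x y) (h : (x, y) ∈ Pgr A B φ) : (A.ρ g x, B.ρ g y) ∈ Pgr A B φ := by
  intro c
  have hc : c = g • (g⁻¹ • c) := by simp
  have := h (g⁻¹ • c)
  rw [hc]
  simp only [← A.ρ_smul, ← B.ρ_smul, tr_rho]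
  exact this

variable [SMulCommClass G k S]

theorem Pgr_evg (hR : IsInv G rS) (u : S ⊗[k] S) (x : X) :
    ∃ y, (∑ g : G, evg k g u • A.ρ g x, y) ∈ Pgr A B φ := by
  induction u using TensorProduct.induction_on with
  | zero => exact ⟨0, by simp only [map_zero, zero_smul, Finset.sum_const_zero]; exact zero_mem _⟩
  | tmul a b =>
    rw [sum_evg]
    exact ⟨_, (Pgr A B φ).smul_mem a (Pgr_inv A B φ hR _)⟩
  | add u v hu hv =>
    obtain ⟨y, hy⟩ := hu
    obtain ⟨z, hz⟩ := hv
    refine ⟨y + z, ?_⟩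
    simp only [map_add, add_smul, Finset.sum_add_distrib]
    exact (Pgr A B φ).add_mem hy hz

variable [IsDomain S]

theorem free_smul_ne [Module.Free S Y] (s : S) (hs : s ≠ 0) (y : Y) (h : s • y = 0) : y = 0 := by
  let b := Module.Free.chooseBasis S Y
  apply b.repr.injective
  ext1 i
  have := congrArg (fun z => b.repr z i) h
  simpa [hs] using this

variable (hR : IsInv G rS) (hE : Enough k S G)

include hE in
theorem Pgr_unique [Module.Free S Y] (x y y') (h : (x, y) ∈ Pgr A B φ)
    (h' : (x, y') ∈ Pgr A B φ) : y = y' := by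
  obtain ⟨u, hu, hu1⟩ := hE.2
  have h2 : ∀ c : S, tr B (c • (y - y')) = 0 := by
    intro c
    have := (Pgr A B φ).sub_mem h h' c
    simp only [Prod.mk_sub_mk, sub_self, smul_zero, tr_zero, map_zero] at this
    exact this.symm
  have h3 := zero_of_tr B _ h2 u
  rw [sum_evg_good B u hu] at h3
  exact sub_eq_zero.1 (free_smul_ne _ hu1 _ h3)

include hR in
theorem Pgr_sat [Module.Free S Y] (s : S) (hs : s ≠ 0) (x y)
    (h : (s • x, s • y) ∈ Pgr A B φ) : (x, y) ∈ Pgr A B φ := by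
  classical
  obtain ⟨N, hN⟩ := hR.2 (∏ g : G, g • s) (by
    intro g
    rw [Finset.smul_prod']
    simp_rw [← mul_smul]
    exact Fintype.prod_equiv (Equiv.mulLeft g) _ _ (fun h => rfl))
  have hN0 : rS N ≠ 0 := by
    rw [hN]
    refine Finset.prod_ne_zero_iff.2 fun g _ => ?_
    simpa [smul_eq_zero_iff_eq] using hs
  have hdv : s ∣ rS N := by
    have := Finset.dvd_prod_of_mem (fun g : G => g • s) (Finset.mem_univ 1)
    rw [hN]
    simpa using this
  obtain ⟨q, hq⟩ := hdv
  intro c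
  have h1 := h (c * q)
  have e : c * q * s = rS N * c := by rw [hq]; ring
  simp only [smul_smul, e] at h1
  simp only [mul_smul, tr_smul_R _ hR, map_smul] at h1
  have h2 : N • (φ (tr A (c • x)) - tr B (c • y)) = 0 := by
    rw [smul_sub, h1, sub_self]
  rw [← sub_eq_zero]
  apply B.i_inj
  rw [map_zero]
  refine free_smul_ne _ hN0 _ ?_
  rw [← B.i_smul, h2, map_zero]

include hR hE in
theorem Pgr_total [UniqueFactorizationMonoid S] [Module.Free S Y] (x) :
    ∃ y, (x, y) ∈ Pgr A B φ := by
  obtain ⟨u, hu, hu1⟩ := hE.2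
  obtain ⟨y, hy⟩ := Pgr_evg A B φ hR u x
  rw [sum_evg_good A u hu] at hy
  set s := evg k (1 : G) u
  let b := Module.Free.chooseBasis S Y
  obtain ⟨z, rfl⟩ : ∃ z, y = s • z := by
    apply basis_dvd b
    intro i
    apply ufd_dvd s _ hu1
    intro f hf
    obtain ⟨v, hv, hv1⟩ := hE.1 f hf
    refine ⟨_, hv1, ?_⟩
    obtain ⟨y', hy'⟩ := Pgr_evg A B φ hR v x
    rw [sum_evg_good A v hv] at hy'
    have e1 := (Pgr A B φ).smul_mem (evg k (1 : G) v) hy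
    have e2 := (Pgr A B φ).smul_mem s hy'
    simp only [Prod.smul_mk] at e1 e2
    rw [smul_comm] at e2
    have e3 := Pgr_unique A B φ hE _ _ _ e1 e2
    have e4 := congrArg (fun z => b.repr z i) e3
    simp only [map_smul, Finsupp.smul_apply, smul_eq_mul] at e4
    exact ⟨_, e4⟩
  exact ⟨z, Pgr_sat A B φ hR s hu1 _ _ hy⟩

variable [UniqueFactorizationMonoid S] [Module.Free S X] [Module.Free S Y] [Module.Free S Z]

/-- the extension -/
noncomputable def extn : X →ₗ[S] Y where
  toFun x := (Pgr_total A B φ hR hE x).choose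
  map_add' x y := Pgr_unique A B φ hE _ _ _ (Pgr_total A B φ hR hE (x + y)).choose_spec
    ((Pgr A B φ).add_mem (Pgr_total A B φ hR hE x).choose_spec (Pgr_total A B φ hR hE y).choose_spec)
  map_smul' s x := Pgr_unique A B φ hE _ _ _ (Pgr_total A B φ hR hE (s • x)).choose_spec
    ((Pgr A B φ).smul_mem s (Pgr_total A B φ hR hE x).choose_spec)

theorem extn_spec (x) : (x, extn A B φ hR hE x) ∈ Pgr A B φ :=
  (Pgr_total A B φ hR hE x).choose_spec

/-- reduction functor -/
noncomputable def Fred (hε : ∀ c, ε (algebraMap k S c) = c) : W →ₗ[k] W' where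
  toFun w := B.e (extn A B φ hR hE (A.j w))
  map_add' x y := by simp only [map_add]
  map_smul' c x := by rw [A.j_smul, map_smul, B.e_smul, hε, RingHom.id_apply]

variable (hε : ∀ c, ε (algebraMap k S c) = c)

theorem Fred_apply (w : W) : Fred A B φ hR hE hε w = B.e (extn A B φ hR hE (A.j w)) := rfl

theorem eps_extn (x : X) :
    B.e (extn A B φ hR hE x) = Fred A B φ hR hE hε (A.e x) := by
  have hx : x ∈ Submodule.span S (Set.range A.j) := by rw [A.j_span]; trivial
  induction hx using Submodule.span_induction with
  | zero => simp
  | mem x hx =>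
    obtain ⟨w, rfl⟩ := hx
    rw [A.e_j, Fred_apply]
  | smul s x _ hx => rw [map_smul, B.e_smul, A.e_smul, map_smul, hx]
  | add x y _ _ hx hy => rw [map_add, map_add, map_add, map_add, hx, hy]

theorem Fred_equiv (g : G) (w : W) :
    Fred A B φ hR hE hε (g • w) = g • Fred A B φ hR hE hε w := by
  rw [Fred_apply, Fred_apply, ← B.e_eq]
  congr 1
  apply Pgr_unique A B φ hE _ _ _ (extn_spec A B φ hR hE _)
  have := Pgr_rho A B φ g _ _ (extn_spec A B φ hR hE (A.j w))
  rwa [A.j_eq] at this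

theorem Fred_id : Fred A A LinearMap.id hR hE hε = LinearMap.id := by
  ext w
  rw [Fred_apply, Pgr_unique A A _ hE _ _ (A.j w) (extn_spec A A _ hR hE _) (fun c => rfl),
    A.e_j, LinearMap.id_apply]

theorem Fred_add (φ' : M →ₗ[R] N) :
    Fred A B (φ + φ') hR hE hε = Fred A B φ hR hE hε + Fred A B φ' hR hE hε := by
  ext w
  rw [LinearMap.add_apply, Fred_apply, Fred_apply, Fred_apply, ← map_add]
  congr 1
  apply Pgr_unique A B _ hE _ _ _ (extn_spec A B _ hR hE _)
  intro c
  have e1 := extn_spec A B φ hR hE (A.j w) c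
  have e2 := extn_spec A B φ' hR hE (A.j w) c
  simp only [LinearMap.add_apply, smul_add, tr_add] at *
  rw [e1, e2]

theorem Fred_zero : Fred A B 0 hR hE hε = 0 := by
  have := Fred_add A B 0 hR hE hε 0
  rw [add_zero] at this
  simpa using this

theorem Fred_sum {ι : Type} (s : Finset ι) (φ : ι → (M →ₗ[R] N)) :
    Fred A B (∑ i ∈ s, φ i) hR hE hε = ∑ i ∈ s, Fred A B (φ i) hR hE hε := by
  classical
  induction s using Finset.induction_on with
  | empty => simp [Fred_zero]
  | insert i s hi ih => rw [Finset.sum_insert hi, Finset.sum_insert hi, Fred_add, ih]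

theorem Fred_comp :
    Fred A C (ψ ∘ₗ φ) hR hE hε = Fred B C ψ hR hE hε ∘ₗ Fred A B φ hR hE hε := by
  ext w
  rw [LinearMap.comp_apply, Fred_apply, Fred_apply A B φ, ← eps_extn]
  congr 1
  apply Pgr_unique A C _ hE _ _ _ (extn_spec A C _ hR hE _)
  intro c
  have e1 := extn_spec A B φ hR hE (A.j w) c
  have e2 := extn_spec B C ψ hR hE (extn A B φ hR hE (A.j w)) c
  simp only [LinearMap.comp_apply] at *
  rw [e1, e2]

end Two
end Abs

section Irr
variable (k : Type) [Field k] (G : Type) [Group G] [Fintype G]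
variable {W : Type} [AddCommGroup W] [Module k W] [DistribMulAction G W] [SMulCommClass G k W]
variable {W' : Type} [AddCommGroup W'] [Module k W'] [DistribMulAction G W'] [SMulCommClass G k W']

theorem schur_zero (hW : IsIrreducibleRep k G W) (hW' : IsIrreducibleRep k G W')
    (hn : ¬ IsRepIso k G W W') (f : W →ₗ[k] W') (hf : ∀ (g : G) (w : W), f (g • w) = g • f w) :
    f = 0 := by
  by_contra h
  have hk : LinearMap.ker f = ⊥ := by
    rcases hW.2 (LinearMap.ker f) (fun g x hx => by
      rw [LinearMap.mem_ker] at *; rw [hf, hx, smul_zero]) with h' | h'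
    · exact h'
    · exact absurd (LinearMap.ker_eq_top.1 h') h
  have hr : LinearMap.range f = ⊤ := by
    rcases hW'.2 (LinearMap.range f) (fun g x hx => by
      obtain ⟨y, rfl⟩ := hx; exact ⟨g • y, hf g y⟩) with h' | h'
    · exact absurd (LinearMap.range_eq_bot.1 h') h
    · exact h'
  exact hn ⟨LinearEquiv.ofBijective f ⟨LinearMap.ker_eq_bot.1 hk, LinearMap.range_eq_top.1 hr⟩, hf⟩

theorem irr_fd (hW : IsIrreducibleRep k G W) : Module.Finite k W := by
  obtain ⟨⟨w, hw⟩, h⟩ := And.intro (@exists_ne W hW.1 0) hW.2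
  have := h (Submodule.span k (Set.range fun g : G => g • w)) (by
    intro g x hx
    induction hx using Submodule.span_induction with
    | mem x hx =>
      obtain ⟨h, rfl⟩ := hx
      exact Submodule.subset_span ⟨g * h, mul_smul _ _ _⟩
    | zero => simp
    | add x y _ _ hx hy => rw [smul_add]; exact add_mem hx hy
    | smul c x _ hx => rw [smul_comm g c x]; exact Submodule.smul_mem _ _ hx)
  rcases this with h' | h'
  · exfalso
    apply hw
    have : w ∈ Submodule.span k (Set.range fun g : G => g • w) :=
      Submodule.subset_span ⟨1, one_smul _ _⟩
    rwa [h', Submodule.mem_bot] at this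
  · exact ⟨h' ▸ Submodule.fg_span (Set.finite_range _)⟩

end Irr

section Comb
variable {k R : Type} [Field k] [CommRing R] {n : ℕ}

/-- component of a map between products -/
noncomputable def comp' {M : Fin (n+1) → Type} [∀ i, AddCommGroup (M i)] [∀ i, Module R (M i)]
    {a b : Fin (n+1) → ℕ}
    (α : (∀ i, Fin (a i) → M i) →ₗ[R] (∀ i, Fin (b i) → M i))
    (i j : Fin (n+1)) (r : Fin (a i)) (s : Fin (b j)) : M i →ₗ[R] M j :=
  LinearMap.proj s ∘ₗ LinearMap.proj j ∘ₗ α ∘ₗ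
    LinearMap.single R (fun i => Fin (a i) → M i) i ∘ₗ LinearMap.single R (fun _ => M i) r

theorem comp'_sum {M : Fin (n+1) → Type} [∀ i, AddCommGroup (M i)] [∀ i, Module R (M i)]
    {a b : Fin (n+1) → ℕ}
    (α : (∀ i, Fin (a i) → M i) →ₗ[R] (∀ i, Fin (b i) → M i))
    (β : (∀ i, Fin (b i) → M i) →ₗ[R] (∀ i, Fin (a i) → M i))
    (h : ∀ x, β (α x) = x) (i : Fin (n+1)) (r r' : Fin (a i)) :
    ∑ j, ∑ s, comp' β j i s r' ∘ₗ comp' α i j r s = if r = r' then LinearMap.id else 0 := by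
  ext m
  set y := α (Pi.single i (Pi.single r m)) with hy
  have e : y = ∑ j, ∑ s, Pi.single j (Pi.single s (y j s)) := by
    ext j s
    simp only [Finset.sum_apply]
    rw [Finset.sum_eq_single j]
    · rw [Finset.sum_eq_single s]
      · simp
      · intro t _ ht; simp [Pi.single_eq_of_ne ht.symm]
      · simp
    · intro j' _ hj'
      simp [Pi.single_eq_of_ne hj'.symm]
    · simp
  have h2 : β y i r' = if r = r' then m else 0 := by
    rw [hy, h, Pi.single_eq_same, Pi.single_apply]
    simp [eq_comm]
  rw [e] at h2
  simp only [map_sum, Finset.sum_apply] at h2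
  have h3 : (if r = r' then LinearMap.id else 0 : M i →ₗ[R] M i) m = if r = r' then m else 0 := by
    split_ifs <;> rfl
  rw [h3, ← h2]
  simp only [LinearMap.sum_apply]
  rfl

end Comb

section Final

/-- the matrix of reductions -/
noncomputable def matF {k R S G : Type} [Field k] [CommRing R] [CommRing S] [Algebra k S] [Group G]
    [MulSemiringAction G S] [Fintype G] [SMulCommClass G k S] [IsDomain S]
    [UniqueFactorizationMonoid S] {rS : R →+* S} {ε : S →+* k} {n : ℕ}
    {X M W : Fin (n + 1) → Type}
    [∀ i, AddCommGroup (X i)] [∀ i, Module S (X i)] [∀ i, AddCommGroup (M i)] [∀ i, Module R (M i)]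
    [∀ i, AddCommGroup (W i)] [∀ i, Module k (W i)] [∀ i, DistribMulAction G (W i)]
    [∀ i, Module.Free S (X i)]
    (A : ∀ i, EqMod k R S G (X i) (M i) (W i) rS ε)
    (hR : IsInv G rS) (hE : Enough k S G) (hε : ∀ c, ε (algebraMap k S c) = c)
    {a b : Fin (n + 1) → ℕ}
    (α : (∀ i, Fin (a i) → M i) →ₗ[R] (∀ i, Fin (b i) → M i)) (i : Fin (n + 1)) :
    (Fin (a i) → W i) →ₗ[k] (Fin (b i) → W i) :=
  LinearMap.pi fun s => ∑ r, Fred (A i) (A i) (comp' α i i r s) hR hE hε ∘ₗ LinearMap.proj r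

theorem matF_left {k R S G : Type} [Field k] [CommRing R] [CommRing S] [Algebra k S] [Group G]
    [MulSemiringAction G S] [Fintype G] [SMulCommClass G k S] [IsDomain S]
    [UniqueFactorizationMonoid S] {rS : R →+* S} {ε : S →+* k} {n : ℕ}
    {X M W : Fin (n + 1) → Type}
    [∀ i, AddCommGroup (X i)] [∀ i, Module S (X i)] [∀ i, AddCommGroup (M i)] [∀ i, Module R (M i)]
    [∀ i, AddCommGroup (W i)] [∀ i, Module k (W i)] [∀ i, DistribMulAction G (W i)]
    [∀ i, SMulCommClass G k (W i)]
    [∀ i, Module.Free S (X i)]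
    (A : ∀ i, EqMod k R S G (X i) (M i) (W i) rS ε)
    (hR : IsInv G rS) (hE : Enough k S G) (hε : ∀ c, ε (algebraMap k S c) = c)
    (hirr : ∀ i, IsIrreducibleRep k G (W i))
    (hdist : ∀ i j, i ≠ j → ¬ IsRepIso k G (W i) (W j))
    {a b : Fin (n + 1) → ℕ}
    (α : (∀ i, Fin (a i) → M i) →ₗ[R] (∀ i, Fin (b i) → M i))
    (β : (∀ i, Fin (b i) → M i) →ₗ[R] (∀ i, Fin (a i) → M i))
    (h : ∀ x, β (α x) = x) (i : Fin (n + 1)) (w : Fin (a i) → W i) :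
    matF A hR hE hε β i (matF A hR hE hε α i w) = w := by
  have key : ∀ r r' : Fin (a i), ∑ s, Fred (A i) (A i) (comp' β i i s r') hR hE hε ∘ₗ
      Fred (A i) (A i) (comp' α i i r s) hR hE hε = if r = r' then LinearMap.id else 0 := by
    intro r r'
    have e := congrArg (fun ψ => Fred (A i) (A i) ψ hR hE hε) (comp'_sum α β h i r r')
    simp only [Fred_sum] at e
    rw [Finset.sum_eq_single i] at e
    · simp only [Fred_comp (A i) (A i) (A i)] at e
      rw [e]
      split_ifs
      · exact Fred_id (A i) hR hE hε
      · exact Fred_zero (A i) (A i) hR hE hε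
    · intro j _ hj
      refine Finset.sum_eq_zero fun s _ => ?_
      rw [Fred_comp (A i) (A j) (A i),
        schur_zero k G (hirr i) (hirr j) (hdist i j hj.symm)
        (Fred (A i) (A j) (comp' α i j r s) hR hE hε) (Fred_equiv _ _ _ hR hE hε),
        LinearMap.comp_zero]
    · simp
  ext r'
  simp only [matF, LinearMap.pi_apply, LinearMap.sum_apply, LinearMap.comp_apply,
    LinearMap.proj_apply, map_sum]
  rw [Finset.sum_comm]
  have : ∀ r, ∑ s, Fred (A i) (A i) (comp' β i i s r') hR hE hε
      (Fred (A i) (A i) (comp' α i i r s) hR hE hε (w r))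
      = if r = r' then w r else 0 := by
    intro r
    have e := DFunLike.congr_fun (key r r') (w r)
    simp only [LinearMap.sum_apply, LinearMap.comp_apply] at e
    rw [e]
    split_ifs <;> rfl
  simp only [this]
  simp

theorem abs_final {k R S G : Type} [Field k] [CommRing R] [CommRing S] [Algebra k S] [Group G]
    [MulSemiringAction G S] [Fintype G] [SMulCommClass G k S] [IsDomain S]
    [UniqueFactorizationMonoid S] {rS : R →+* S} {ε : S →+* k} {n : ℕ}
    {X M W : Fin (n + 1) → Type}
    [∀ i, AddCommGroup (X i)] [∀ i, Module S (X i)] [∀ i, AddCommGroup (M i)] [∀ i, Module R (M i)]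
    [∀ i, AddCommGroup (W i)] [∀ i, Module k (W i)] [∀ i, DistribMulAction G (W i)]
    [∀ i, SMulCommClass G k (W i)]
    [∀ i, Module.Free S (X i)]
    (A : ∀ i, EqMod k R S G (X i) (M i) (W i) rS ε)
    (hR : IsInv G rS) (hE : Enough k S G) (hε : ∀ c, ε (algebraMap k S c) = c)
    (hirr : ∀ i, IsIrreducibleRep k G (W i))
    (hdist : ∀ i j, i ≠ j → ¬ IsRepIso k G (W i) (W j))
    {a b : Fin (n + 1) → ℕ}
    (α : (∀ i, Fin (a i) → M i) ≃ₗ[R] (∀ i, Fin (b i) → M i)) : a = b := by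
  funext i
  have := irr_fd k G (hirr i)
  have := (hirr i).1
  have e : (Fin (a i) → W i) ≃ₗ[k] (Fin (b i) → W i) :=
    LinearEquiv.ofLinearMap (matF A hR hE hε α.toLinearMap i)
      (matF A hR hE hε α.symm.toLinearMap i)
      (LinearMap.ext fun w => matF_left A hR hE hε hirr hdist α.symm.toLinearMap
        α.toLinearMap (fun x => α.apply_symm_apply x) i w)
      (LinearMap.ext fun w => matF_left A hR hE hε hirr hdist α.toLinearMap
        α.symm.toLinearMap (fun x => α.symm_apply_apply x) i w)
  have hfr := e.finrank_eq
  rw [Module.finrank_pi_fintype, Module.finrank_pi_fintype] at hfr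
  simp only [Finset.sum_const, Finset.card_univ, Fintype.card_fin, smul_eq_mul] at hfr
  exact Nat.eq_of_mul_eq_mul_right Module.finrank_pos hfr

end Final

section Conc

variable (k : Type) [Field k] (d : ℕ) (G : Type) [Group G] [Fintype G]
variable [MulSemiringAction G (MvPolynomial (Fin d) k)]
variable [SMulCommClass G k (MvPolynomial (Fin d) k)]
variable (W : Type) [AddCommGroup W] [Module k W] [DistribMulAction G W] [SMulCommClass G k W]

theorem diag_tmul (g : G) (s : MvPolynomial (Fin d) k) (w : W) :
    diagAction k d G W g (s ⊗ₜ w) = (g • s) ⊗ₜ (g • w) := rfl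

theorem diag_one (x : MvPolynomial (Fin d) k ⊗[k] W) : diagAction k d G W 1 x = x := by
  induction x using TensorProduct.induction_on with
  | zero => simp
  | tmul s w => simp [diag_tmul]
  | add x y hx hy => rw [map_add, hx, hy]

theorem diag_mul (g h : G) (x : MvPolynomial (Fin d) k ⊗[k] W) :
    diagAction k d G W (g * h) x = diagAction k d G W g (diagAction k d G W h x) := by
  induction x using TensorProduct.induction_on with
  | zero => simp
  | tmul s w => simp [diag_tmul, mul_smul]
  | add x y hx hy => rw [map_add, hx, hy, map_add, map_add]

theorem exists_not_dvd
    (hlin : ∀ (g : G) (j : Fin d),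
      g • (X j : MvPolynomial (Fin d) k) ∈ Submodule.span k (Set.range X))
    (hfaithful : ∀ g : G, (∀ s : MvPolynomial (Fin d) k, g • s = s) → g = 1)
    (hps : ∀ g : G, g ≠ 1 → Module.finrank k
      (Submodule.span k (Set.range fun j : Fin d =>
        g • (X j : MvPolynomial (Fin d) k) - X j)) ≠ 1)
    (g : G) (hg : g ≠ 1) (f : MvPolynomial (Fin d) k) (hf : Irreducible f) :
    ∃ h : MvPolynomial (Fin d) k, ¬ f ∣ g • h - h := by
  by_contra! hcon
  have hdeg : ∀ j, (g • (X j : MvPolynomial (Fin d) k) - X j).totalDegree ≤ 1 := by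
    intro j
    have h1 : Submodule.span k (Set.range (X : Fin d → MvPolynomial (Fin d) k)) ≤
        restrictTotalDegree (Fin d) k 1 := by
      rw [Submodule.span_le]
      rintro _ ⟨i, rfl⟩
      simp [mem_restrictTotalDegree]
    have := h1 (sub_mem (hlin g j) (Submodule.subset_span ⟨j, rfl⟩))
    simpa [mem_restrictTotalDegree] using this
  have hfd : 1 ≤ f.totalDegree := by
    by_contra! h0
    have h0 : f.totalDegree = 0 := by omega
    rw [totalDegree_eq_zero_iff_eq_C] at h0
    apply hf.not_isUnit
    rw [h0]
    have : coeff 0 f ≠ 0 := by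
      intro h
      apply hf.ne_zero
      rw [h0, h, C_0]
    exact (IsUnit.mk0 _ this).map C
  have hle : Submodule.span k (Set.range fun j : Fin d =>
        g • (X j : MvPolynomial (Fin d) k) - X j) ≤ Submodule.span k {f} := by
    rw [Submodule.span_le]
    rintro _ ⟨j, rfl⟩
    have hj := hdeg j
    obtain ⟨q, hq⟩ := hcon (X j)
    simp only [SetLike.mem_coe]
    rw [hq] at hj ⊢
    by_cases hq0 : q = 0
    · simp [hq0]
    rw [totalDegree_mul_of_isDomain hf.ne_zero hq0] at hj
    have : q.totalDegree = 0 := by omega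
    rw [totalDegree_eq_zero_iff_eq_C] at this
    rw [Submodule.mem_span_singleton]
    exact ⟨coeff 0 q, by rw [smul_eq_C_mul, mul_comm, ← this]⟩
  have h1 := Submodule.finrank_mono hle
  have h2 := finrank_span_singleton (K := k) hf.ne_zero
  have h3 := hps g hg
  have h4 : Module.finrank k
      (Submodule.span k (Set.range fun j : Fin d =>
        g • (X j : MvPolynomial (Fin d) k) - X j)) = 0 := by omega
  have hfin : Module.Finite k (Submodule.span k (Set.range fun j : Fin d =>
        g • (X j : MvPolynomial (Fin d) k) - X j)) :=
    Module.Finite.span_of_finite k (Set.finite_range _)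
  rw [Submodule.finrank_eq_zero] at h4
  apply hg
  apply hfaithful
  have h5 : MulSemiringAction.toAlgHom k (MvPolynomial (Fin d) k) g = AlgHom.id k _ := by
    apply MvPolynomial.algHom_ext
    intro j
    have : g • (X j : MvPolynomial (Fin d) k) - X j ∈ Submodule.span k (Set.range fun j : Fin d =>
        g • (X j : MvPolynomial (Fin d) k) - X j) := Submodule.subset_span ⟨j, rfl⟩
    rw [h4, Submodule.mem_bot, sub_eq_zero] at this
    simpa using this
  intro s
  exact DFunLike.congr_fun h5 s

theorem enough_of
    (hlin : ∀ (g : G) (j : Fin d),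
      g • (X j : MvPolynomial (Fin d) k) ∈ Submodule.span k (Set.range X))
    (hfaithful : ∀ g : G, (∀ s : MvPolynomial (Fin d) k, g • s = s) → g = 1)
    (hps : ∀ g : G, g ≠ 1 → Module.finrank k
      (Submodule.span k (Set.range fun j : Fin d =>
        g • (X j : MvPolynomial (Fin d) k) - X j)) ≠ 1) :
    Enough k (MvPolynomial (Fin d) k) G := by
  classical
  constructor
  · intro f hf
    have : ∀ g : G, ∃ h : MvPolynomial (Fin d) k, g ≠ 1 → ¬ f ∣ g • h - h := by
      intro g
      by_cases hg : g = 1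
      · exact ⟨0, fun h => absurd hg h⟩
      · obtain ⟨h, hh⟩ := exists_not_dvd k d G hlin hfaithful hps g hg f hf
        exact ⟨h, fun _ => hh⟩
    choose h hh using this
    obtain ⟨u, hu, hu1⟩ := good_of k (MvPolynomial (Fin d) k) h
    exact ⟨u, hu, hu1 f (Or.inl hf.prime) hh⟩
  · have : ∀ g : G, ∃ h : MvPolynomial (Fin d) k, g ≠ 1 → ¬ 0 ∣ g • h - h := by
      intro g
      by_contra! hc
      have h1 : g ≠ 1 := (hc 0).1
      exact h1 (hfaithful g fun s => sub_eq_zero.1 (zero_dvd_iff.1 (hc s).2))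
    choose h hh using this
    obtain ⟨u, hu, hu1⟩ := good_of k (MvPolynomial (Fin d) k) h
    exact ⟨u, hu, fun h0 => hu1 0 (Or.inr ⟨rfl, inferInstance⟩) hh (zero_dvd_iff.2 h0)⟩

variable {W}

/-- reduction at the origin -/
noncomputable def eps (W : Type) [AddCommGroup W] [Module k W] :
    (MvPolynomial (Fin d) k ⊗[k] W) →ₗ[k] W :=
  (TensorProduct.lid k W).toLinearMap ∘ₗ
    TensorProduct.map (MvPolynomial.aeval (fun _ => (0 : k))).toLinearMap LinearMap.id

theorem eps_tmul (s : MvPolynomial (Fin d) k) (w : W) :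
    eps k d W (s ⊗ₜ w) = (constantCoeff s) • w := by
  simp [eps, MvPolynomial.aeval_zero']

theorem eps_smul (s : MvPolynomial (Fin d) k) (x : MvPolynomial (Fin d) k ⊗[k] W) :
    eps k d W (s • x) = (constantCoeff s) • eps k d W x := by
  induction x using TensorProduct.induction_on with
  | zero => simp
  | tmul s' w => rw [TensorProduct.smul_tmul', eps_tmul, eps_tmul, smul_eq_mul, map_mul, mul_smul]
  | add x y hx hy => rw [smul_add, map_add, map_add, smul_add, hx, hy]

theorem constCoeff_smul
    (hlin : ∀ (g : G) (j : Fin d),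
      g • (X j : MvPolynomial (Fin d) k) ∈ Submodule.span k (Set.range X))
    (g : G) (s : MvPolynomial (Fin d) k) : constantCoeff (g • s) = constantCoeff s := by
  have h : (MvPolynomial.aeval (fun _ => (0 : k))).comp
      (MulSemiringAction.toAlgHom k (MvPolynomial (Fin d) k) g) =
      (MvPolynomial.aeval (fun _ : Fin d => (0 : k))) := by
    apply MvPolynomial.algHom_ext
    intro j
    have h1 : Submodule.span k (Set.range (X : Fin d → MvPolynomial (Fin d) k)) ≤
        LinearMap.ker (MvPolynomial.aeval (fun _ : Fin d => (0 : k))).toLinearMap := by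
      rw [Submodule.span_le]
      rintro _ ⟨i, rfl⟩
      simp
    have h2 : (MvPolynomial.aeval (fun _ : Fin d => (0 : k))) (g • (X j : MvPolynomial (Fin d) k))
      = 0 := h1 (hlin g j)
    simpa using h2
  have := DFunLike.congr_fun h s
  simpa [MvPolynomial.aeval_zero'] using this

theorem eps_diag
    (hlin : ∀ (g : G) (j : Fin d),
      g • (X j : MvPolynomial (Fin d) k) ∈ Submodule.span k (Set.range X))
    (g : G) (x : MvPolynomial (Fin d) k ⊗[k] W) :
    eps k d W (diagAction k d G W g x) = g • eps k d W x := by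
  induction x using TensorProduct.induction_on with
  | zero => simp
  | tmul s' w => rw [diag_tmul, eps_tmul, eps_tmul, constCoeff_smul k d G hlin, smul_comm g]
  | add x y hx hy => rw [map_add, map_add, map_add, smul_add, hx, hy]

variable (W) in
/-- the concrete package -/
noncomputable def conc (hlin : ∀ (g : G) (j : Fin d),
      g • (X j : MvPolynomial (Fin d) k) ∈ Submodule.span k (Set.range X)) :
    EqMod k (invariantSubalgebra k d G) (MvPolynomial (Fin d) k) G
      (MvPolynomial (Fin d) k ⊗[k] W) (invariantsTensor k d G W) W
      (invariantSubalgebra k d G).val.toRingHom constantCoeff where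
  ρ g := (diagAction k d G W g).toAddMonoidHom
  ρ_one := diag_one k d G W
  ρ_mul := diag_mul k d G W
  ρ_smul := diagAction_smul k d G W
  i := (invariantsTensor k d G W).toAddSubmonoid.subtype
  i_inj _ _ h := Subtype.ext h
  i_smul _ _ := rfl
  i_fix g m := m.2 g
  i_surj x hx := ⟨⟨x, hx⟩, rfl⟩
  j := (TensorProduct.mk k (MvPolynomial (Fin d) k) W 1).toAddMonoidHom
  j_smul c w := by
    change (1 : MvPolynomial (Fin d) k) ⊗ₜ[k] (c • w) = algebraMap k (MvPolynomial (Fin d) k) c •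
      ((1 : MvPolynomial (Fin d) k) ⊗ₜ[k] w)
    rw [TensorProduct.tmul_smul, algebraMap_smul]
  j_eq g w := by
    change diagAction k d G W g (1 ⊗ₜ w) = 1 ⊗ₜ (g • w)
    rw [diag_tmul, smul_one]
  j_span := by
    rw [eq_top_iff]
    rintro x -
    induction x using TensorProduct.induction_on with
    | zero => exact zero_mem _
    | tmul s w =>
      have : s ⊗ₜ[k] w = s • ((1 : MvPolynomial (Fin d) k) ⊗ₜ[k] w) := by
        rw [TensorProduct.smul_tmul', smul_eq_mul, mul_one]
      rw [this]
      exact Submodule.smul_mem _ _ (Submodule.subset_span ⟨w, rfl⟩)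
    | add x y hx hy => exact add_mem hx hy
  e := (eps k d W).toAddMonoidHom
  e_smul := eps_smul k d
  e_eq := eps_diag k d G hlin
  e_j w := by
    change eps k d W (1 ⊗ₜ w) = w
    rw [eps_tmul, map_one, one_smul]

theorem conc_inv : IsInv G (invariantSubalgebra k d G).val.toRingHom :=
  ⟨fun g r => r.2 g, fun s hs => ⟨⟨s, hs⟩, rfl⟩⟩

end Conc

theorem multiplicities_unique
    (k : Type) [Field k] [IsAlgClosed k] (p : ℕ) [Fact p.Prime] [CharP k p]
    (d n : ℕ) (G : Type) [Group G] [Fintype G]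
    [MulSemiringAction G (MvPolynomial (Fin d) k)]
    [SMulCommClass G k (MvPolynomial (Fin d) k)]
    -- the order of `G` is not divisible by `p`
    (hord : ¬ p ∣ Fintype.card G)
    -- the action of `G` on `S` is induced by a linear action on `V = ⟨x_1, …, x_d⟩`
    (hlin : ∀ (g : G) (j : Fin d),
      g • (X j : MvPolynomial (Fin d) k) ∈ Submodule.span k (Set.range X))
    -- `G ⊆ GL(V)`: the action is faithful
    (hfaithful : ∀ g : G, (∀ s : MvPolynomial (Fin d) k, g • s = s) → g = 1)
    -- `G` contains no pseudo-reflections: for `g ≠ 1`, `rank (g - 1)|_V ≠ 1`, where the image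
    -- of `(g - 1)|_V` is spanned by the elements `g • x_j - x_j`
    (hps : ∀ g : G, g ≠ 1 → Module.finrank k
      (Submodule.span k (Set.range fun j : Fin d =>
        g • (X j : MvPolynomial (Fin d) k) - X j)) ≠ 1)
    -- `V_0 = k, V_1, …, V_n`: a complete set of pairwise non-isomorphic irreducible
    -- representations of `G` over `k`, with `V_0` the trivial one-dimensional representation
    (W : Fin (n + 1) → Type) [∀ i, AddCommGroup (W i)] [∀ i, Module k (W i)]
    [∀ i, DistribMulAction G (W i)] [∀ i, SMulCommClass G k (W i)]
    (hirr : ∀ i, IsIrreducibleRep k G (W i))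
    (hdist : ∀ i j, i ≠ j → ¬ IsRepIso k G (W i) (W j))
    (hcomplete : ∀ (P : Type) [AddCommGroup P] [Module k P] [DistribMulAction G P]
      [SMulCommClass G k P], IsIrreducibleRep k G P → ∃ i, IsRepIso k G P (W i))
    (htriv : Module.finrank k (W 0) = 1 ∧ ∀ (g : G) (x : W 0), g • x = x)
    (a b : Fin (n + 1) → ℕ)
    (hab : Nonempty ((∀ i : Fin (n + 1), Fin (a i) → invariantsTensor k d G (W i)) ≃ₗ[invariantSubalgebra k d G]
      (∀ i : Fin (n + 1), Fin (b i) → invariantsTensor k d G (W i)))) :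
    a = b := by
  obtain ⟨α⟩ := hab
  exact abs_final (fun i => conc k d G (W i) hlin) (conc_inv k d G)
    (enough_of k d G hlin hfaithful hps) (fun c => constantCoeff_C _ c) hirr hdist α
end

section
/- R has finite F-representation type by {M_0 ≅ R, M_1, …, M_n}: for every e ∈ ℕ there exist nonnegative integers c_0,…,c_n such that ᵉR ≅ ⊕_{i=0}^{n} M_i^{⊕ c_i} as R-modules. -/
/-!
`R = S^G` has finite F-representation type by `{M_0 ≅ R, M_1, …, M_n}`: for every `e`
there are multiplicities `c_i` with `ᵉR ≅ ⊕_i M_i^{⊕ c_i}` as `R`-modules (an additive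
isomorphism `φ` with `φ (r^{p^e} * x) = r • φ x`, i.e. `R`-linearity from `ᵉR`).
-/

set_option linter.unusedSectionVars false
set_option synthInstance.maxHeartbeats 1000000
set_option maxHeartbeats 1600000

open MvPolynomial TensorProduct

section Part1

variable (k : Type) [Field k] (p : ℕ) [Fact p.Prime] [CharP k p] (d e : ℕ)

noncomputable def rmon (q : ℕ) (a : Fin d → Fin q) : MvPolynomial (Fin d) k :=
  monomial (Finsupp.equivFunOnFinite.symm fun i => (a i : ℕ)) 1

theorem pow_q_eq (s : MvPolynomial (Fin d) k) :
    s ^ p ^ e = expand (p ^ e) (map (iterateFrobenius k p e) s) := by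
  rw [← map_expand, map_iterateFrobenius_expand]

theorem rmon_indep (s : (Fin d → Fin (p ^ e)) → MvPolynomial (Fin d) k)
    (h : ∑ a, s a ^ p ^ e * rmon k d (p ^ e) a = 0) (a : Fin d → Fin (p ^ e)) : s a = 0 := by
  have hq : p ^ e ≠ 0 := pow_ne_zero _ (Fact.out : p.Prime).ne_zero
  ext b
  have h1 := congrArg (coeff ((p ^ e) • b +
    (Finsupp.equivFunOnFinite.symm fun i => (a i : ℕ)))) h
  rw [coeff_sum, Finset.sum_eq_single a] at h1
  · rw [rmon, coeff_mul_monomial, pow_q_eq, coeff_expand_smul _ hq, coeff_map,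
      iterateFrobenius_def] at h1
    rw [coeff_zero, mul_one] at h1
    rw [coeff_zero]
    exact pow_eq_zero_iff hq |>.mp h1
  · intro a' _ hne
    rw [rmon, coeff_mul_monomial', pow_q_eq]
    split_ifs with hle
    · obtain ⟨i, hi⟩ := Function.ne_iff.mp hne
      rw [coeff_expand_of_not_dvd (i := i), zero_mul]
      intro hdvd
      have h2 := hle i
      simp only [Finsupp.coe_tsub, Finsupp.coe_add, Finsupp.coe_smul, Pi.sub_apply, Pi.add_apply,
        Pi.smul_apply, Finsupp.equivFunOnFinite_symm_apply_apply, smul_eq_mul] at hdvd h2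
      have h3 := (Nat.modEq_iff_dvd' h2).mpr hdvd
      apply hi
      apply Fin.ext
      have h4 : (a' i : ℕ) % p ^ e = (p ^ e * b i + a i) % p ^ e := h3
      rwa [Nat.mul_add_mod, Nat.mod_eq_of_lt (a' i).2, Nat.mod_eq_of_lt (a i).2] at h4
    · rfl
  · simp

theorem rmon_span [IsAlgClosed k] (f : MvPolynomial (Fin d) k) :
    ∃ s : (Fin d → Fin (p ^ e)) → MvPolynomial (Fin d) k,
      ∑ a, s a ^ p ^ e * rmon k d (p ^ e) a = f := by
  have hp : p.Prime := Fact.out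
  have hq : 0 < p ^ e := pow_pos hp.pos _
  induction f using MvPolynomial.induction_on' with
  | monomial u c =>
    obtain ⟨c', hc'⟩ := IsAlgClosed.exists_pow_nat_eq c hq
    refine ⟨Pi.single (fun i => ⟨u i % p ^ e, Nat.mod_lt _ hq⟩)
      (monomial (Finsupp.equivFunOnFinite.symm fun i => u i / p ^ e) c'), ?_⟩
    rw [Finset.sum_eq_single (fun i => ⟨u i % p ^ e, Nat.mod_lt _ hq⟩)]
    · rw [Pi.single_eq_same, rmon, monomial_pow, monomial_mul, hc', mul_one]
      have : (p ^ e • (Finsupp.equivFunOnFinite.symm fun i => u i / p ^ e) +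
            Finsupp.equivFunOnFinite.symm fun i => u i % p ^ e) = u := by
        ext i
        simp [Nat.div_add_mod]
      exact congrArg (fun w => monomial w c) this
    · intro b _ hb
      rw [Pi.single_eq_of_ne hb, zero_pow hq.ne', zero_mul]
    · simp
  | add f g hf hg =>
    obtain ⟨s, rfl⟩ := hf
    obtain ⟨t, rfl⟩ := hg
    refine ⟨s + t, ?_⟩
    rw [← Finset.sum_add_distrib]
    refine Finset.sum_congr rfl fun a _ => ?_
    rw [Pi.add_apply, ← add_mul, add_pow_expChar_pow]

def Tw (_p _e : ℕ) : Type := MvPolynomial (Fin d) k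

noncomputable instance : AddCommGroup (Tw k d p e) :=
  inferInstanceAs (AddCommGroup (MvPolynomial (Fin d) k))

noncomputable instance : Module (MvPolynomial (Fin d) k) (Tw k d p e) :=
  Module.compHom (MvPolynomial (Fin d) k) (iterateFrobenius (MvPolynomial (Fin d) k) p e)

noncomputable instance : Module k (Tw k d p e) :=
  Module.compHom (MvPolynomial (Fin d) k) (iterateFrobenius k p e)

noncomputable def toTw : MvPolynomial (Fin d) k ≃+ Tw k d p e := AddEquiv.refl _

theorem smul_toTw (s x : MvPolynomial (Fin d) k) :
    s • toTw k p d e x = toTw k p d e (s ^ p ^ e * x) := rfl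

theorem ksmul_toTw (s : k) (x : MvPolynomial (Fin d) k) :
    s • toTw k p d e x = toTw k p d e (s ^ p ^ e • x) := rfl

instance : IsScalarTower k (MvPolynomial (Fin d) k) (Tw k d p e) where
  smul_assoc a s x := by
    obtain ⟨x, rfl⟩ := (toTw k p d e).surjective x
    rw [smul_toTw, smul_toTw, ksmul_toTw, smul_pow, smul_mul_assoc]

noncomputable def twBasis [IsAlgClosed k] :
    Module.Basis (Fin d → Fin (p ^ e)) (MvPolynomial (Fin d) k) (Tw k d p e) :=
  Module.Basis.mk (v := fun a => toTw k p d e (rmon k d (p ^ e) a))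
    (by
      rw [Fintype.linearIndependent_iff]
      intro s hs
      apply rmon_indep
      simp_rw [smul_toTw, ← map_sum] at hs
      exact (map_eq_zero_iff _ (toTw k p d e).injective).mp hs)
    (by
      rintro x -
      obtain ⟨x, rfl⟩ := (toTw k p d e).surjective x
      obtain ⟨s, rfl⟩ := rmon_span k p d e x
      rw [map_sum]
      refine Submodule.sum_mem _ fun a _ => ?_
      rw [← smul_toTw]
      exact Submodule.smul_mem _ _ (Submodule.subset_span ⟨a, rfl⟩))

/-- a spanning family of the right cardinality is a basis -/
theorem tw_indep [IsAlgClosed k] (v : (Fin d → Fin (p ^ e)) → Tw k d p e)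
    (hv : ⊤ ≤ Submodule.span (MvPolynomial (Fin d) k) (Set.range v)) :
    LinearIndependent (MvPolynomial (Fin d) k) v := by
  let b := twBasis k p d e
  let f : Tw k d p e →ₗ[MvPolynomial (Fin d) k] Tw k d p e := b.constr k v
  have hf : Function.Surjective f := by
    rw [← LinearMap.range_eq_top, Module.Basis.constr_range]
    exact top_le_iff.mp hv
  have : Module.Finite (MvPolynomial (Fin d) k) (Tw k d p e) := Module.Finite.of_basis b
  have hi := OrzechProperty.injective_of_surjective_endomorphism f hf
  have := b.linearIndependent.map' f (LinearMap.ker_eq_bot.mpr hi)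
  have h2 : f ∘ b = v := by
    ext1 a
    exact Module.Basis.constr_basis ..
  rw [h2] at this
  exact this

end Part1

section Part2

variable (k : Type) [Field k] (d q : ℕ)

open Classical in
noncomputable def nred : MvPolynomial (Fin d) k →ₗ[k] MvPolynomial (Fin d) k :=
  (basisMonomials (Fin d) k).constr k
    (fun u => if ∃ i, q ≤ u i then monomial u 1 else 0)

open Classical in
theorem nred_monomial (u : Fin d →₀ ℕ) (c : k) :
    nred k d q (monomial u c) = if ∃ i, q ≤ u i then monomial u c else 0 := by
  have h : (monomial u c : MvPolynomial (Fin d) k) = c • basisMonomials (Fin d) k u := by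
    simp [smul_monomial]
  rw [h, map_smul, nred, Module.Basis.constr_basis]
  split_ifs <;> simp

theorem nred_X_pow_mul (i : Fin d) (f : MvPolynomial (Fin d) k) :
    nred k d q (f * X i ^ q) = f * X i ^ q := by
  induction f using MvPolynomial.induction_on' with
  | monomial u c =>
    rw [X_pow_eq_monomial, monomial_mul, nred_monomial, if_pos]
    exact ⟨i, by simp⟩
  | add f g hf hg => rw [add_mul, map_add, hf, hg]

theorem monomial_dvd (u : Fin d →₀ ℕ) (c : k) (i : Fin d) (h : q ≤ u i) :
    (monomial u c : MvPolynomial (Fin d) k)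
      = monomial (u - Finsupp.single i q) c * X i ^ q := by
  rw [X_pow_eq_monomial, monomial_mul, mul_one, tsub_add_cancel_of_le]
  rwa [Finsupp.single_le_iff]

noncomputable def frobI : Ideal (MvPolynomial (Fin d) k) :=
  Ideal.span (Set.range fun i => X i ^ q)

theorem nred_of_mem (f : MvPolynomial (Fin d) k) (hf : f ∈ frobI k d q) :
    nred k d q f = f := by
  rw [frobI, Ideal.span, Submodule.mem_span_range_iff_exists_fun] at hf
  obtain ⟨c, rfl⟩ := hf
  rw [map_sum]
  exact Finset.sum_congr rfl fun i _ => nred_X_pow_mul k d q i (c i)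

variable (G : Type) [Group G] [Fintype G]
variable [MulSemiringAction G (MvPolynomial (Fin d) k)]
variable [SMulCommClass G k (MvPolynomial (Fin d) k)]

noncomputable def avg : MvPolynomial (Fin d) k →ₗ[k] MvPolynomial (Fin d) k :=
  (Fintype.card G : k)⁻¹ • ∑ g : G,
    DistribSMul.toLinearMap k _ g ∘ₗ nred k d q ∘ₗ DistribSMul.toLinearMap k _ g⁻¹

theorem avg_apply (x : MvPolynomial (Fin d) k) :
    avg k d q G x = (Fintype.card G : k)⁻¹ • ∑ g : G, g • nred k d q (g⁻¹ • x) := by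
  simp [avg, LinearMap.sum_apply]

theorem avg_smul (h : G) (x : MvPolynomial (Fin d) k) :
    avg k d q G (h • x) = h • avg k d q G x := by
  have h1 : ∑ g : G, g • nred k d q (g⁻¹ • h • x) = h • ∑ g : G, g • nred k d q (g⁻¹ • x) := by
    rw [Finset.smul_sum, ← Equiv.sum_comp (Equiv.mulLeft h) (fun g => g • nred k d q (g⁻¹ • h • x))]
    refine Finset.sum_congr rfl fun g _ => ?_
    simp [mul_smul]
  rw [avg_apply, avg_apply, h1, smul_comm h]

theorem avg_of_mem (hc : (Fintype.card G : k) ≠ 0)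
    (hI : ∀ (g : G), ∀ f ∈ frobI k d q, g • f ∈ frobI k d q)
    (f : MvPolynomial (Fin d) k) (hf : f ∈ frobI k d q) : avg k d q G f = f := by
  have h : ∑ g : G, g • nred k d q (g⁻¹ • f) = ∑ _g : G, f := by
    refine Finset.sum_congr rfl fun g _ => ?_
    rw [nred_of_mem _ _ _ _ (hI _ _ hf), smul_inv_smul]
  rw [avg_apply, h, Finset.sum_const, Finset.card_univ, ← Nat.cast_smul_eq_nsmul k, smul_smul,
      inv_mul_cancel₀ hc, one_smul]

theorem sub_avg_mem (hc : (Fintype.card G : k) ≠ 0)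
    (hI : ∀ (g : G), ∀ f ∈ frobI k d q, g • f ∈ frobI k d q)
    (f : MvPolynomial (Fin d) k) :
    f - avg k d q G f ∈ Submodule.span k
      (Set.range fun a => rmon k d q a - avg k d q G (rmon k d q a)) := by
  induction f using MvPolynomial.induction_on' with
  | monomial u c =>
    by_cases h : ∃ i, q ≤ u i
    · obtain ⟨i, hi⟩ := h
      rw [avg_of_mem k d q G hc hI, sub_self]
      · exact Submodule.zero_mem _
      · rw [monomial_dvd k d q u c i hi]
        exact Ideal.mul_mem_left _ _ (Ideal.subset_span ⟨i, rfl⟩)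
    · push Not at h
      have h1 : (monomial u c : MvPolynomial (Fin d) k)
          = c • rmon k d q (fun i => ⟨u i, h i⟩) := by
        rw [rmon, smul_monomial, smul_eq_mul, mul_one]
        have : (Finsupp.equivFunOnFinite.symm fun i => u i) = u := by ext; simp
        exact congrArg (fun w => monomial w c) this.symm
      rw [h1, map_smul, ← smul_sub]
      exact Submodule.smul_mem _ _ (Submodule.subset_span ⟨_, rfl⟩)
  | add f g hf hg =>
    rw [map_add, add_sub_add_comm]
    exact Submodule.add_mem _ hf hg

theorem smul_C_eq (g : G) (c : k) : g • (C c : MvPolynomial (Fin d) k) = C c := by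
  rw [← algebraMap_eq, Algebra.algebraMap_eq_smul_one, smul_comm, smul_one]

variable (hlin : ∀ (g : G) (j : Fin d),
      g • (X j : MvPolynomial (Fin d) k) ∈ Submodule.span k (Set.range X))

theorem totalDegree_X_le (hlin : ∀ (g : G) (j : Fin d),
      g • (X j : MvPolynomial (Fin d) k) ∈ Submodule.span k (Set.range X)) (g : G) (j : Fin d) :
    (g • (X j : MvPolynomial (Fin d) k)).totalDegree ≤ 1 := by
  have h : Submodule.span k (Set.range (X : Fin d → MvPolynomial (Fin d) k)) ≤
      restrictTotalDegree (Fin d) k 1 := by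
    rw [Submodule.span_le]
    rintro _ ⟨i, rfl⟩
    simp [mem_restrictTotalDegree]
  exact (mem_restrictTotalDegree _ _ _).mp (h (hlin g j))

theorem totalDegree_smul_le' (hlin : ∀ (g : G) (j : Fin d),
      g • (X j : MvPolynomial (Fin d) k) ∈ Submodule.span k (Set.range X)) (g : G)
    (f : MvPolynomial (Fin d) k) : (g • f).totalDegree ≤ f.totalDegree := by
  conv_lhs => rw [f.as_sum, Finset.smul_sum]
  refine totalDegree_finsetSum_le fun u hu => ?_
  refine le_trans ?_ (le_totalDegree hu)
  rw [monomial_eq, smul_mul', smul_C_eq]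
  refine (totalDegree_mul _ _).trans ?_
  rw [totalDegree_C, zero_add, Finsupp.prod, Finset.smul_prod']
  refine (totalDegree_finsetProd _ _).trans ?_
  rw [Finsupp.sum]
  refine Finset.sum_le_sum fun i _ => ?_
  rw [smul_pow']
  refine (totalDegree_pow _ _).trans ?_
  have := totalDegree_X_le k d G hlin g i
  nlinarith [Nat.zero_le (u i)]

theorem frobI_stable (p : ℕ) [Fact p.Prime] [CharP k p] (e : ℕ) (hlin : ∀ (g : G) (j : Fin d),
      g • (X j : MvPolynomial (Fin d) k) ∈ Submodule.span k (Set.range X)) (g : G)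
    (f : MvPolynomial (Fin d) k) (hf : f ∈ frobI k d (p ^ e)) : g • f ∈ frobI k d (p ^ e) := by
  rw [frobI, Ideal.span, Submodule.mem_span_range_iff_exists_fun] at hf
  obtain ⟨c, rfl⟩ := hf
  rw [Finset.smul_sum]
  refine Ideal.sum_mem _ fun i _ => ?_
  rw [smul_eq_mul, smul_mul', smul_pow']
  refine Ideal.mul_mem_left _ _ ?_
  obtain ⟨t, ht⟩ := (Submodule.mem_span_range_iff_exists_fun k).mp (hlin g i)
  rw [← ht, sum_pow_char_pow]
  refine Ideal.sum_mem _ fun j _ => ?_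
  rw [smul_pow, smul_eq_C_mul]
  exact Ideal.mul_mem_left _ _ (Ideal.subset_span ⟨j, rfl⟩)

variable (p : ℕ) [Fact p.Prime] [CharP k p] (e : ℕ)

noncomputable def vfam (a : Fin d → Fin (p ^ e)) : MvPolynomial (Fin d) k :=
  rmon k d (p ^ e) a - avg k d (p ^ e) G (rmon k d (p ^ e) a)

/-- the (twisted) representation -/
noncomputable def Crep : Submodule k (Tw k d p e) :=
  Submodule.span k (Set.range fun a => toTw k p d e (vfam k d G p e a))

theorem mem_Crep [IsAlgClosed k] (f : MvPolynomial (Fin d) k)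
    (hf : f ∈ Submodule.span k (Set.range (vfam k d G p e))) :
    toTw k p d e f ∈ Crep k d G p e := by
  have hq : 0 < p ^ e := pow_pos (Fact.out : p.Prime).pos _
  rw [Submodule.mem_span_range_iff_exists_fun] at hf
  obtain ⟨c, rfl⟩ := hf
  rw [map_sum]
  refine Submodule.sum_mem _ fun a _ => ?_
  obtain ⟨c', hc'⟩ := IsAlgClosed.exists_pow_nat_eq (c a) hq
  rw [← hc', ← ksmul_toTw]
  exact Submodule.smul_mem _ _ (Submodule.subset_span ⟨a, rfl⟩)

noncomputable instance : DistribMulAction G (Tw k d p e) :=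
  inferInstanceAs (DistribMulAction G (MvPolynomial (Fin d) k))

theorem gsmul_toTw (g : G) (x : MvPolynomial (Fin d) k) :
    g • toTw k p d e x = toTw k p d e (g • x) := rfl

theorem gsmul_smul (g : G) (s : MvPolynomial (Fin d) k) (x : Tw k d p e) :
    g • (s • x) = (g • s) • (g • x) := by
  obtain ⟨x, rfl⟩ := (toTw k p d e).surjective x
  rw [smul_toTw, gsmul_toTw, gsmul_toTw, smul_toTw, smul_mul', smul_pow']

instance : SMulCommClass G k (Tw k d p e) where
  smul_comm g c x := by
    obtain ⟨x, rfl⟩ := (toTw k p d e).surjective x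
    rw [ksmul_toTw, gsmul_toTw, gsmul_toTw, ksmul_toTw, smul_comm]

theorem Crep_stable [IsAlgClosed k] (hc : (Fintype.card G : k) ≠ 0)
    (hlin : ∀ (g : G) (j : Fin d),
      g • (X j : MvPolynomial (Fin d) k) ∈ Submodule.span k (Set.range X))
    (g : G) (x : Tw k d p e) (hx : x ∈ Crep k d G p e) : g • x ∈ Crep k d G p e := by
  rw [Crep, Submodule.mem_span_range_iff_exists_fun] at hx
  obtain ⟨c, rfl⟩ := hx
  rw [Finset.smul_sum]
  refine Submodule.sum_mem _ fun a _ => ?_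
  rw [smul_comm]
  refine Submodule.smul_mem _ _ ?_
  rw [gsmul_toTw]
  apply mem_Crep
  rw [vfam, smul_sub, ← avg_smul]
  exact sub_avg_mem k d (p ^ e) G hc (frobI_stable k d G p e hlin) _

theorem Crep_span_stable [IsAlgClosed k] (hc : (Fintype.card G : k) ≠ 0)
    (hlin : ∀ (g : G) (j : Fin d),
      g • (X j : MvPolynomial (Fin d) k) ∈ Submodule.span k (Set.range X))
    (g : G) (x : Tw k d p e)
    (hx : x ∈ Submodule.span (MvPolynomial (Fin d) k) (Crep k d G p e : Set (Tw k d p e))) :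
    g • x ∈ Submodule.span (MvPolynomial (Fin d) k) (Crep k d G p e : Set (Tw k d p e)) := by
  induction hx using Submodule.span_induction with
  | mem x hx => exact Submodule.subset_span (Crep_stable k d G p e hc hlin g x hx)
  | zero => rw [smul_zero]; exact Submodule.zero_mem _
  | add x y _ _ hx hy => rw [smul_add]; exact Submodule.add_mem _ hx hy
  | smul s x _ hx => rw [gsmul_smul]; exact Submodule.smul_mem _ _ hx

theorem Crep_span [IsAlgClosed k] (hc : (Fintype.card G : k) ≠ 0)
    (hlin : ∀ (g : G) (j : Fin d),
      g • (X j : MvPolynomial (Fin d) k) ∈ Submodule.span k (Set.range X))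
    (n : ℕ) : ∀ (f : MvPolynomial (Fin d) k), f.totalDegree < n → toTw k p d e f ∈
      Submodule.span (MvPolynomial (Fin d) k) (Crep k d G p e : Set (Tw k d p e)) := by
  have hq : 0 < p ^ e := pow_pos (Fact.out : p.Prime).pos _
  induction n with
  | zero => intro f hf; omega
  | succ n ih =>
    have key : ∀ (f : MvPolynomial (Fin d) k), f.totalDegree < n + 1 →
        toTw k p d e (nred k d (p ^ e) f) ∈
      Submodule.span (MvPolynomial (Fin d) k) (Crep k d G p e : Set (Tw k d p e)) := by
      intro f hf
      rw [f.as_sum, map_sum, map_sum]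
      refine Submodule.sum_mem _ fun u hu => ?_
      rw [nred_monomial]
      split_ifs with h
      · obtain ⟨i, hi⟩ := h
        rw [monomial_dvd k d _ u _ i hi, mul_comm, ← smul_toTw]
        refine Submodule.smul_mem _ _ (ih _ ?_)
        have h1 := le_totalDegree hu
        rw [totalDegree_monomial _ (mem_support_iff.mp hu)]
        have h2 : u - Finsupp.single i (p ^ e) + Finsupp.single i (p ^ e) = u :=
          tsub_add_cancel_of_le (by rwa [Finsupp.single_le_iff])
        have h3 : (u.sum fun _ e => e) =
            ((u - Finsupp.single i (p ^ e)).sum fun _ e => e) + p ^ e := by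
          conv_lhs => rw [← h2]
          rw [Finsupp.sum_add_index' (by simp) (by simp), Finsupp.sum_single_index rfl]
        omega
      · rw [map_zero]; exact Submodule.zero_mem _
    intro f hf
    rw [← sub_add_cancel f (avg k d (p ^ e) G f), map_add]
    refine Submodule.add_mem _ (Submodule.subset_span (mem_Crep k d G p e _
      (sub_avg_mem k d (p ^ e) G hc (frobI_stable k d G p e hlin) _))) ?_
    rw [avg_apply, smul_eq_C_mul]
    obtain ⟨c', hc'⟩ := IsAlgClosed.exists_pow_nat_eq ((Fintype.card G : k)⁻¹) hq
    rw [← hc', map_pow, ← smul_toTw]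
    refine Submodule.smul_mem _ _ ?_
    rw [map_sum]
    refine Submodule.sum_mem _ fun g _ => ?_
    rw [← gsmul_toTw]
    apply Crep_span_stable k d G p e hc hlin
    exact key _ ((totalDegree_smul_le' k d G hlin _ _).trans_lt hf)

theorem vfam_indep [IsAlgClosed k] (hc : (Fintype.card G : k) ≠ 0)
    (hlin : ∀ (g : G) (j : Fin d),
      g • (X j : MvPolynomial (Fin d) k) ∈ Submodule.span k (Set.range X)) :
    LinearIndependent (MvPolynomial (Fin d) k) (fun a => toTw k p d e (vfam k d G p e a)) ∧
    ⊤ ≤ Submodule.span (MvPolynomial (Fin d) k)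
      (Set.range fun a => toTw k p d e (vfam k d G p e a)) := by
  have h : ⊤ ≤ Submodule.span (MvPolynomial (Fin d) k)
      (Set.range fun a => toTw k p d e (vfam k d G p e a)) := by
    rintro x -
    obtain ⟨f, rfl⟩ := (toTw k p d e).surjective x
    have := Crep_span k d G p e hc hlin _ f (Nat.lt_succ_self _)
    rw [Crep, Submodule.span_span_of_tower] at this
    exact this
  exact ⟨tw_indep k p d e _ h, h⟩

theorem theta_bij [IsAlgClosed k] (hc : (Fintype.card G : k) ≠ 0)
    (hlin : ∀ (g : G) (j : Fin d),
      g • (X j : MvPolynomial (Fin d) k) ∈ Submodule.span k (Set.range X)) :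
    Function.Bijective ((Crep k d G p e).subtype.liftBaseChange (MvPolynomial (Fin d) k)) := by
  obtain ⟨h1, h2⟩ := vfam_indep k d G p e hc hlin
  let b := Module.Basis.mk h1 h2
  have h3 : LinearIndependent k (fun a => toTw k p d e (vfam k d G p e a)) :=
    h1.restrict_scalars' k
  let c : Module.Basis _ k (Crep k d G p e) := Module.Basis.span h3
  let E := (c.baseChange (MvPolynomial (Fin d) k)).equiv b (Equiv.refl _)
  have : (Crep k d G p e).subtype.liftBaseChange (MvPolynomial (Fin d) k) = E.toLinearMap := by
    refine (c.baseChange (MvPolynomial (Fin d) k)).ext fun a => ?_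
    rw [LinearEquiv.coe_coe, Module.Basis.equiv_apply, Module.Basis.baseChange_apply,
      LinearMap.liftBaseChange_tmul, one_smul, Equiv.refl_apply, Module.Basis.mk_apply,
      Submodule.subtype_apply]
    exact congrArg Subtype.val (Module.Basis.span_apply h3 a)
  rw [this]
  exact E.bijective

end Part2

section Part3

variable (k : Type) [Field k] (d : ℕ) (G : Type) [Group G] [Fintype G]
variable [MulSemiringAction G (MvPolynomial (Fin d) k)]
variable [SMulCommClass G k (MvPolynomial (Fin d) k)]

/-- functoriality of `invariantsTensor` -/
noncomputable def invMap {A B : Type} [AddCommGroup A] [Module k A] [DistribMulAction G A]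
    [SMulCommClass G k A] [AddCommGroup B] [Module k B] [DistribMulAction G B]
    [SMulCommClass G k B] (f : A →ₗ[k] B) (hf : ∀ (g : G) (x : A), f (g • x) = g • f x) :
    invariantsTensor k d G A →ₗ[invariantSubalgebra k d G] invariantsTensor k d G B where
  toFun x := ⟨f.baseChange (MvPolynomial (Fin d) k) x.1, by
    intro g
    have h : ∀ y : MvPolynomial (Fin d) k ⊗[k] A,
        diagAction k d G B g (f.baseChange (MvPolynomial (Fin d) k) y) =
        f.baseChange (MvPolynomial (Fin d) k) (diagAction k d G A g y) := by
      intro y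
      induction y using TensorProduct.induction_on with
      | zero => simp
      | tmul s a =>
        simp only [diagAction, TensorProduct.map_tmul, LinearMap.baseChange_tmul,
          DistribSMul.toLinearMap_apply, DistribMulAction.toLinearMap, hf]
      | add x y hx hy => simp only [map_add, hx, hy]
    rw [h, x.2 g]⟩
  map_add' x y := by
    apply Subtype.ext
    exact map_add _ _ _
  map_smul' r x := by
    apply Subtype.ext
    exact map_smul (f.baseChange (MvPolynomial (Fin d) k)) (r : MvPolynomial (Fin d) k) x.1

variable {k G}

theorem invMap_val {A B : Type} [AddCommGroup A] [Module k A] [DistribMulAction G A]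
    [SMulCommClass G k A] [AddCommGroup B] [Module k B] [DistribMulAction G B]
    [SMulCommClass G k B] (f : A →ₗ[k] B) (hf : ∀ (g : G) (x : A), f (g • x) = g • f x)
    (x : invariantsTensor k d G A) :
    (invMap k d G f hf x).1 = f.baseChange (MvPolynomial (Fin d) k) x.1 := rfl

noncomputable def invSplit {A B P : Type} [AddCommGroup A] [Module k A] [DistribMulAction G A]
    [SMulCommClass G k A] [AddCommGroup B] [Module k B] [DistribMulAction G B]
    [SMulCommClass G k B] [AddCommGroup P] [Module k P] [DistribMulAction G P]
    [SMulCommClass G k P]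
    (i : A →ₗ[k] P) (hi : ∀ (g : G) (x : A), i (g • x) = g • i x)
    (j : B →ₗ[k] P) (hj : ∀ (g : G) (x : B), j (g • x) = g • j x)
    (r : P →ₗ[k] A) (hr : ∀ (g : G) (x : P), r (g • x) = g • r x)
    (s : P →ₗ[k] B) (hs : ∀ (g : G) (x : P), s (g • x) = g • s x)
    (h1 : r ∘ₗ i = LinearMap.id) (h2 : s ∘ₗ j = LinearMap.id) (h3 : r ∘ₗ j = 0)
    (h4 : s ∘ₗ i = 0) (h5 : i ∘ₗ r + j ∘ₗ s = LinearMap.id) :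
    invariantsTensor k d G P ≃ₗ[invariantSubalgebra k d G]
      invariantsTensor k d G A × invariantsTensor k d G B :=
  LinearEquiv.ofLinear ((invMap k d G r hr).prod (invMap k d G s hs))
    ((invMap k d G i hi).coprod (invMap k d G j hj))
    (by
      refine LinearMap.ext fun x => ?_
      obtain ⟨a, b⟩ := x
      simp only [LinearMap.comp_apply, LinearMap.prod_apply, Function.prod_apply,
        LinearMap.coprod_apply, LinearMap.id_apply, Prod.mk.injEq]
      constructor
      · apply Subtype.ext
        rw [map_add, Submodule.coe_add, invMap_val, invMap_val, invMap_val, invMap_val,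
          ← LinearMap.comp_apply, ← LinearMap.comp_apply, ← LinearMap.baseChange_comp,
          ← LinearMap.baseChange_comp, h1, h3, LinearMap.baseChange_id, LinearMap.baseChange_zero,
          LinearMap.id_apply, LinearMap.zero_apply, add_zero]
      · apply Subtype.ext
        rw [map_add, Submodule.coe_add, invMap_val, invMap_val, invMap_val, invMap_val,
          ← LinearMap.comp_apply, ← LinearMap.comp_apply, ← LinearMap.baseChange_comp,
          ← LinearMap.baseChange_comp, h2, h4, LinearMap.baseChange_id, LinearMap.baseChange_zero,
          LinearMap.id_apply, LinearMap.zero_apply, zero_add])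
    (by
      refine LinearMap.ext fun x => ?_
      simp only [LinearMap.comp_apply, LinearMap.prod_apply, Function.prod_apply,
        LinearMap.coprod_apply, LinearMap.id_apply]
      apply Subtype.ext
      simp only [Submodule.coe_add, invMap_val]
      rw [← LinearMap.comp_apply, ← LinearMap.comp_apply,
          ← LinearMap.baseChange_comp, ← LinearMap.baseChange_comp, ← LinearMap.add_apply,
          ← LinearMap.baseChange_add, h5, LinearMap.baseChange_id, LinearMap.id_apply])

noncomputable def invEquiv {A B : Type} [AddCommGroup A] [Module k A] [DistribMulAction G A]
    [SMulCommClass G k A] [AddCommGroup B] [Module k B] [DistribMulAction G B]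
    [SMulCommClass G k B]
    (f : A ≃ₗ[k] B) (hf : ∀ (g : G) (x : A), f (g • x) = g • f x) :
    invariantsTensor k d G A ≃ₗ[invariantSubalgebra k d G] invariantsTensor k d G B :=
  LinearEquiv.ofLinear (invMap k d G f.toLinearMap hf)
    (invMap k d G f.symm.toLinearMap (fun g x => f.injective (by simp [hf])))
    (by
      refine LinearMap.ext fun x => Subtype.ext ?_
      simp only [LinearMap.comp_apply, invMap_val]
      rw [← LinearMap.comp_apply, ← LinearMap.baseChange_comp]
      simp)
    (by
      refine LinearMap.ext fun x => Subtype.ext ?_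
      simp only [LinearMap.comp_apply, invMap_val]
      rw [← LinearMap.comp_apply, ← LinearMap.baseChange_comp]
      simp)

abbrev stableAct {P : Type} [AddCommGroup P] [Module k P] [DistribMulAction G P]
    (N : Submodule k P) (hN : ∀ g : G, ∀ x ∈ N, g • x ∈ N) : DistribMulAction G N where
  smul g x := ⟨g • x.1, hN g x.1 x.2⟩
  one_smul x := Subtype.ext (one_smul G x.1)
  mul_smul g h x := Subtype.ext (mul_smul g h x.1)
  smul_zero g := Subtype.ext (smul_zero g)
  smul_add g x y := Subtype.ext (smul_add g x.1 y.1)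

theorem maschke {P : Type} [AddCommGroup P] [Module k P] [DistribMulAction G P]
    [SMulCommClass G k P] (hc : (Fintype.card G : k) ≠ 0)
    (N : Submodule k P) (hN : ∀ g : G, ∀ x ∈ N, g • x ∈ N) :
    ∃ E : P →ₗ[k] P, (∀ (g : G) (x : P), E (g • x) = g • E x) ∧ (∀ x, E x ∈ N) ∧
      ∀ x ∈ N, E x = x := by
  obtain ⟨r, hr⟩ := N.subtype.exists_leftInverse_of_injective N.ker_subtype
  let E : P →ₗ[k] P := (Fintype.card G : k)⁻¹ • ∑ g : G,
    DistribSMul.toLinearMap k _ g ∘ₗ (N.subtype ∘ₗ r) ∘ₗ DistribSMul.toLinearMap k _ g⁻¹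
  have hE : ∀ x, E x = (Fintype.card G : k)⁻¹ • ∑ g : G, g • (r (g⁻¹ • x) : P) := by
    intro x
    simp [E, LinearMap.sum_apply]
  refine ⟨E, ?_, ?_, ?_⟩
  · intro h x
    have h1 : ∑ g : G, g • (r (g⁻¹ • h • x) : P) = h • ∑ g : G, g • (r (g⁻¹ • x) : P) := by
      rw [Finset.smul_sum, ← Equiv.sum_comp (Equiv.mulLeft h) (fun g => g • (r (g⁻¹ • h • x) : P))]
      refine Finset.sum_congr rfl fun g _ => ?_
      simp [mul_smul]
    rw [hE, hE, h1, smul_comm h]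
  · intro x
    rw [hE]
    exact Submodule.smul_mem _ _ (Submodule.sum_mem _ fun g _ => hN _ _ (Subtype.mem _))
  · intro x hx
    have h : ∑ g : G, g • (r (g⁻¹ • x) : P) = ∑ _g : G, x := by
      refine Finset.sum_congr rfl fun g _ => ?_
      have := LinearMap.congr_fun hr ⟨g⁻¹ • x, hN _ _ hx⟩
      simp only [LinearMap.comp_apply, Submodule.subtype_apply, LinearMap.id_apply] at this
      rw [this, smul_inv_smul]
    rw [hE, h, Finset.sum_const, Finset.card_univ, ← Nat.cast_smul_eq_nsmul k, smul_smul,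
        inv_mul_cancel₀ hc, one_smul]

theorem decomp (hc : (Fintype.card G : k) ≠ 0) (n : ℕ)
    (W : Fin (n + 1) → Type) [∀ i, AddCommGroup (W i)] [∀ i, Module k (W i)]
    [∀ i, DistribMulAction G (W i)] [∀ i, SMulCommClass G k (W i)]
    (hcomplete : ∀ (P : Type) [AddCommGroup P] [Module k P] [DistribMulAction G P]
      [SMulCommClass G k P], IsIrreducibleRep k G P → ∃ i, IsRepIso k G P (W i)) (m : ℕ) :
    ∀ (P : Type) [AddCommGroup P] [Module k P] [DistribMulAction G P]
      [SMulCommClass G k P] [Module.Finite k P], Module.finrank k P < m →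
      ∃ (J : Type) (_ : Fintype J) (t : J → Fin (n + 1)),
        Nonempty (invariantsTensor k d G P ≃ₗ[invariantSubalgebra k d G]
          ∀ j, invariantsTensor k d G (W (t j))) := by
  induction m with
  | zero => intro P _ _ _ _ _ h; omega
  | succ m ih =>
    intro P _ _ _ _ _ hm
    rcases subsingleton_or_nontrivial P with hP | hP
    · refine ⟨Empty, inferInstance, Empty.elim, ⟨?_⟩⟩
      have : Subsingleton (MvPolynomial (Fin d) k ⊗[k] P) := by
        refine subsingleton_of_forall_eq 0 fun x => ?_
        induction x using TensorProduct.induction_on with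
        | zero => rfl
        | tmul s a => rw [Subsingleton.elim a 0, TensorProduct.tmul_zero]
        | add x y hx hy => rw [hx, hy, add_zero]
      exact LinearEquiv.ofSubsingleton _ _
    · by_cases hirr : IsIrreducibleRep k G P
      · obtain ⟨i, f, hf⟩ := hcomplete P hirr
        exact ⟨Unit, inferInstance, fun _ => i,
          ⟨(invEquiv d f hf).trans (LinearEquiv.funUnique Unit _ _).symm⟩⟩
      · rw [IsIrreducibleRep] at hirr
        push Not at hirr
        obtain ⟨N, hN, hbot, htop⟩ := hirr hP
        obtain ⟨E, hE1, hE2, hE3⟩ := maschke hc N hN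
        let N' := LinearMap.ker E
        have hN' : ∀ g : G, ∀ x ∈ N', g • x ∈ N' := by
          intro g x hx
          rw [LinearMap.mem_ker] at hx ⊢
          rw [hE1, hx, smul_zero]
        have hlt : N < ⊤ := lt_top_iff_ne_top.mpr htop
        have hlt' : N' < ⊤ := by
          rw [lt_top_iff_ne_top]
          intro h
          apply hbot
          rw [Submodule.eq_bot_iff]
          intro x hx
          rw [← hE3 x hx]
          have hx' : x ∈ N' := by rw [h]; exact Submodule.mem_top
          exact LinearMap.mem_ker.mp hx'
        have hd := Submodule.finrank_lt hlt.ne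
        have hd' := Submodule.finrank_lt hlt'.ne
        let _ := stableAct N hN
        let _ := stableAct N' hN'
        have : SMulCommClass G k N := ⟨fun g c x => Subtype.ext (smul_comm g c x.1)⟩
        have : SMulCommClass G k N' := ⟨fun g c x => Subtype.ext (smul_comm g c x.1)⟩
        obtain ⟨J, _, t, ⟨f⟩⟩ := ih N (by omega)
        obtain ⟨J', _, t', ⟨f'⟩⟩ := ih N' (by omega)
        have hk : ∀ x, ((LinearMap.id - E : P →ₗ[k] P)) x ∈ N' := by
          intro x
          rw [LinearMap.mem_ker]
          simp [hE3 _ (hE2 x)]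
        let F := invSplit d N.subtype (fun g x => rfl) N'.subtype (fun g x => rfl)
          (E.codRestrict N hE2) (fun g x => Subtype.ext (hE1 g x))
          ((LinearMap.id - E : P →ₗ[k] P).codRestrict N' hk)
          (fun g x => Subtype.ext (by
            change g • x - E (g • x) = g • (x - E x)
            rw [hE1, smul_sub]))
          (LinearMap.ext fun x => Subtype.ext (hE3 x.1 x.2))
          (LinearMap.ext fun x => Subtype.ext (by
            change x.1 - E x.1 = x.1
            rw [LinearMap.mem_ker.mp x.2, sub_zero]))
          (LinearMap.ext fun x => Subtype.ext (LinearMap.mem_ker.mp x.2))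
          (LinearMap.ext fun x => Subtype.ext (by
            change x.1 - E x.1 = 0
            rw [hE3 _ x.2, sub_self]))
          (LinearMap.ext fun x => by
            change E x + (x - E x) = x
            abel)
        refine ⟨J ⊕ J', inferInstance, Sum.elim t t', ⟨?_⟩⟩
        exact F.trans ((f.prodCongr f').trans
          (LinearEquiv.sumPiEquivProdPi _ J J'
            (fun j => invariantsTensor k d G (W (Sum.elim t t' j)))).symm)

/-- regroup a product over `J` by fibres of `t` -/
theorem regroup {R : Type} [CommRing R] {n : ℕ} (M : Fin (n + 1) → Type)
    [∀ i, AddCommGroup (M i)] [∀ i, Module R (M i)] (J : Type) [Fintype J]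
    (t : J → Fin (n + 1)) :
    ∃ c : Fin (n + 1) → ℕ, Nonempty ((∀ j, M (t j)) ≃ₗ[R] (∀ i, Fin (c i) → M i)) := by
  classical
  let ε : ∀ i, {j // t j = i} ≃ Fin (Fintype.card {j // t j = i}) := fun i => Fintype.equivFin _
  refine ⟨fun i => Fintype.card {j // t j = i}, ⟨?_⟩⟩
  let f : (∀ i, Fin (Fintype.card {j // t j = i}) → M i) →ₗ[R] (∀ j, M (t j)) :=
    { toFun := fun f j => f (t j) (ε (t j) ⟨j, rfl⟩)
      map_add' := fun _ _ => rfl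
      map_smul' := fun _ _ => rfl }
  refine (LinearEquiv.ofBijective f ⟨?_, ?_⟩).symm
  · intro x y h
    funext i a
    obtain ⟨⟨j, rfl⟩, rfl⟩ := (ε i).surjective a
    exact congrFun h j
  · intro y
    refine ⟨fun i a => ((ε i).symm a).2 ▸ y ((ε i).symm a).1, ?_⟩
    funext j
    have : ∀ z : {j' // t j' = t j}, z = ⟨j, rfl⟩ → z.2 ▸ y z.1 = y j := by
      rintro _ rfl
      rfl
    exact this _ (Equiv.symm_apply_apply _ _)

end Part3

theorem invariant_subring_FFRT
    (k : Type) [Field k] [IsAlgClosed k] (p : ℕ) [Fact p.Prime] [CharP k p]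
    (d n : ℕ) (G : Type) [Group G] [Fintype G]
    [MulSemiringAction G (MvPolynomial (Fin d) k)]
    [SMulCommClass G k (MvPolynomial (Fin d) k)]
    -- the order of `G` is not divisible by `p`
    (hord : ¬ p ∣ Fintype.card G)
    -- the action of `G` on `S` is induced by a linear action on `V = ⟨x_1, …, x_d⟩`
    (hlin : ∀ (g : G) (j : Fin d),
      g • (X j : MvPolynomial (Fin d) k) ∈ Submodule.span k (Set.range X))
    -- `G ⊆ GL(V)`: the action is faithful
    (hfaithful : ∀ g : G, (∀ s : MvPolynomial (Fin d) k, g • s = s) → g = 1)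
    -- `G` contains no pseudo-reflections: for `g ≠ 1`, `rank (g - 1)|_V ≠ 1`, where the image
    -- of `(g - 1)|_V` is spanned by the elements `g • x_j - x_j`
    (hps : ∀ g : G, g ≠ 1 → Module.finrank k
      (Submodule.span k (Set.range fun j : Fin d =>
        g • (X j : MvPolynomial (Fin d) k) - X j)) ≠ 1)
    -- `V_0 = k, V_1, …, V_n`: a complete set of pairwise non-isomorphic irreducible
    -- representations of `G` over `k`, with `V_0` the trivial one-dimensional representation
    (W : Fin (n + 1) → Type) [∀ i, AddCommGroup (W i)] [∀ i, Module k (W i)]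
    [∀ i, DistribMulAction G (W i)] [∀ i, SMulCommClass G k (W i)]
    (hirr : ∀ i, IsIrreducibleRep k G (W i))
    (hdist : ∀ i j, i ≠ j → ¬ IsRepIso k G (W i) (W j))
    (hcomplete : ∀ (P : Type) [AddCommGroup P] [Module k P] [DistribMulAction G P]
      [SMulCommClass G k P], IsIrreducibleRep k G P → ∃ i, IsRepIso k G P (W i))
    (htriv : Module.finrank k (W 0) = 1 ∧ ∀ (g : G) (x : W 0), g • x = x) :
    ∀ e : ℕ, ∃ c : Fin (n + 1) → ℕ,
      ∃ φ : invariantSubalgebra k d G ≃+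
        (∀ i : Fin (n + 1), Fin (c i) → invariantsTensor k d G (W i)),
      ∀ (r x : invariantSubalgebra k d G), φ (r ^ p ^ e * x) = r • φ x := by
  intro e
  have hc : (Fintype.card G : k) ≠ 0 := by
    rw [Ne, CharP.cast_eq_zero_iff k p]
    exact hord
  let _ := stableAct (Crep k d G p e) (Crep_stable k d G p e hc hlin)
  have : SMulCommClass G k (Crep k d G p e) :=
    ⟨fun g c x => Subtype.ext (smul_comm g c x.1)⟩
  have : Module.Finite k (Crep k d G p e) :=
    Module.Finite.span_of_finite k (Set.finite_range _)
  obtain ⟨J, _, t, ⟨F⟩⟩ := decomp d hc n W hcomplete _ (Crep k d G p e) (Nat.lt_succ_self _)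
  obtain ⟨c, ⟨F'⟩⟩ := regroup (R := invariantSubalgebra k d G)
    (fun i => invariantsTensor k d G (W i)) J t
  let θ := (Crep k d G p e).subtype.liftBaseChange (MvPolynomial (Fin d) k)
  have hθ : Function.Bijective θ := theta_bij k d G p e hc hlin
  have hθG : ∀ (g : G) y, θ (diagAction k d G (Crep k d G p e) g y) = g • θ y := by
    intro g y
    induction y using TensorProduct.induction_on with
    | zero => simp
    | tmul s a =>
      simp only [θ, diagAction, TensorProduct.map_tmul, LinearMap.liftBaseChange_tmul,
        DistribSMul.toLinearMap_apply, DistribMulAction.toLinearMap]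
      rw [gsmul_smul]
      rfl
    | add x y hx hy => simp only [map_add, hx, hy, smul_add]
  let Ψ : invariantsTensor k d G (Crep k d G p e) →+ invariantSubalgebra k d G :=
    { toFun := fun x => ⟨(toTw k p d e).symm (θ x.1), fun g => by
        apply (toTw k p d e).injective
        rw [← gsmul_toTw, AddEquiv.apply_symm_apply, ← hθG, x.2 g]⟩
      map_zero' := by
        apply Subtype.ext
        simp
      map_add' := fun x y => by
        apply Subtype.ext
        simp }
  have hΨ : Function.Bijective Ψ := by
    constructor
    · intro x y h
      apply Subtype.ext
      apply hθ.1
      exact (toTw k p d e).symm.injective (congrArg Subtype.val h)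
    · intro y
      obtain ⟨x, hx⟩ := hθ.2 (toTw k p d e y.1)
      refine ⟨⟨x, fun g => hθ.1 ?_⟩, Subtype.ext ?_⟩
      · rw [hθG, hx, gsmul_toTw, y.2 g]
      · change (toTw k p d e).symm (θ x) = y.1
        rw [hx, AddEquiv.symm_apply_apply]
  have hΨs : ∀ (r : invariantSubalgebra k d G) x, Ψ (r • x) = r ^ p ^ e * Ψ x := by
    intro r x
    apply Subtype.ext
    change (toTw k p d e).symm (θ ((r : MvPolynomial (Fin d) k) • x.1)) =
      (r : MvPolynomial (Fin d) k) ^ p ^ e * (toTw k p d e).symm (θ x.1)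
    apply (toTw k p d e).injective
    rw [map_smul, AddEquiv.apply_symm_apply, ← smul_toTw, AddEquiv.apply_symm_apply]
  let Ψe := AddEquiv.ofBijective Ψ hΨ
  refine ⟨c, Ψe.symm.trans (F.trans F').toAddEquiv, fun r x => ?_⟩
  obtain ⟨y, rfl⟩ := Ψe.surjective x
  have h1 : r ^ p ^ e * Ψe y = Ψe (r • y) := (hΨs r y).symm
  rw [h1, AddEquiv.trans_apply, AddEquiv.trans_apply, AddEquiv.symm_apply_apply,
    AddEquiv.symm_apply_apply]
  exact map_smul (F.trans F') r y
end
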